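/- arXiv:2112.14625 — 2 statements merged into one kernel-verified Lean document; each statement's English description precedes it below -/
import Mathlib

section
/- Let α > 1, V(u;x) = x u² − u^{2α+2} − 1 for u > 0, and ρ = ((α+1)/α)·α^{1/(α+1)} ∈ (1,2]. Then for x > ρ the equation V(u;x) = 0 has exactly two positive roots u₁(x) ∈ (0, α^{−1/(2(1+α))}) and u₂(x) ∈ (α^{−1/(2(1+α))}, ∞); for x = ρ it has the unique positive (double) root u = α^{−1/(2(1+α))}; and for 0 ≤ x < ρ it has no positive root. Moreover the functions u₁, u₂ on [ρ,∞) are continuous, smooth on (ρ,∞), u₁ is strictly decreasing and u₂ strictly increasing; u₁(x) = x^{−1/2} + O(x^{−3/2−α}) and u₂(x) = x^{1/(2α)} + O(x^{−1/(2α)−1}) as x → +∞; and u_k(x) = α^{−1/(2(1+α))} + (−1)^k c₁ (x−ρ)^{1/2} + O(x−ρ) as x → ρ⁺ (k = 1,2), with c₁ = α^{−1/(α+1)}/√(2α+2). -/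
open Real MeasureTheory Set Filter Topology Asymptotics

noncomputable section

/-- V(u;x) = x u² − u^{2α+2} − 1. -/
def Vfun (α x u : ℝ) : ℝ := x * u ^ 2 - u ^ (2 * α + 2) - 1

/-- ρ = ((α+1)/α)·α^{1/(α+1)}. -/
def rhoC (α : ℝ) : ℝ := ((α + 1) / α) * α ^ (1 / (α + 1))

/-- u* = α^{−1/(2(1+α))}. -/
def ustar (α : ℝ) : ℝ := α ^ (-(1 / (2 * (1 + α))))

/-- c₁ = α^{−1/(α+1)}/√(2α+2). -/
def c1C (α : ℝ) : ℝ := α ^ (-(1 / (α + 1))) / Real.sqrt (2 * α + 2)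

/-- The function `A e^{at} + B e^{-bt}`; when `a A = b B` its minimum is attained at `t = 0`. -/
def twoExp (A B a b t : ℝ) : ℝ := A * exp (a * t) + B * exp (-(b * t))

lemma twoExp_zero (A B a b : ℝ) : twoExp A B a b 0 = A + B := by simp [twoExp]

lemma twoExp_neg (A B a b t : ℝ) : twoExp A B a b (-t) = twoExp B A b a t := by
  simp [twoExp, add_comm]

lemma contDiff_twoExp (A B a b : ℝ) : ContDiff ℝ (⊤ : ℕ∞) (twoExp A B a b) := by
  unfold twoExp; fun_prop

lemma hasDerivAt_twoExp (A B a b t : ℝ) :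
    HasDerivAt (twoExp A B a b) (a * A * exp (a * t) - b * B * exp (-(b * t))) t := by
  have h1 : HasDerivAt (fun t : ℝ => a * t) a t := by
    simpa using (hasDerivAt_id t).const_mul a
  have h2 : HasDerivAt (fun t : ℝ => -(b * t)) (-b) t := by
    simpa only [mul_one] using ((hasDerivAt_id' t).const_mul b).fun_neg
  have h := (h1.exp.const_mul A).add (h2.exp.const_mul B)
  refine h.congr_deriv ?_
  ring

lemma twoExp_deriv_pos {A B a b : ℝ} (hA : 0 < A) (ha : 0 < a) (hb : 0 < b)
    (h : a * A = b * B) {t : ℝ} (ht : 0 < t) :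
    0 < a * A * exp (a * t) - b * B * exp (-(b * t)) := by
  rw [← h, ← mul_sub]
  refine mul_pos (mul_pos ha hA) (sub_pos.2 (exp_lt_exp.2 ?_))
  nlinarith [mul_pos ha ht, mul_pos hb ht]

lemma strictMonoOn_twoExp {A B a b : ℝ} (hA : 0 < A) (ha : 0 < a) (hb : 0 < b)
    (h : a * A = b * B) : StrictMonoOn (twoExp A B a b) (Ici 0) := by
  refine strictMonoOn_of_deriv_pos (convex_Ici 0)
    (contDiff_twoExp A B a b).continuous.continuousOn fun t ht => ?_
  rw [interior_Ici, mem_Ioi] at ht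
  rw [(hasDerivAt_twoExp A B a b t).deriv]
  exact twoExp_deriv_pos hA ha hb h ht

/-- The increasing branch of the inverse of `twoExp`, extended to a homeomorphism of the line. -/
lemma exists_twoExp_inverse {A B a b : ℝ} (hA : 0 < A) (hB : 0 < B) (ha : 0 < a) (hb : 0 < b)
    (h : a * A = b * B) :
    ∃ T : ℝ → ℝ, Continuous T ∧ StrictMono T ∧ T (A + B) = 0 ∧
      (∀ x, A + B ≤ x → twoExp A B a b (T x) = x) ∧
      ContDiffOn ℝ (⊤ : ℕ∞) T (Ioi (A + B)) := by
  set F := twoExp A B a b with hF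
  have hmono := strictMonoOn_twoExp hA ha hb h
  have hFc : Continuous F := (contDiff_twoExp A B a b).continuous
  set G : ℝ → ℝ := fun t => F (max t 0) + min t 0 with hG
  have hGF : ∀ t, 0 ≤ t → G t = F t := fun t ht => by simp [hG, ht]
  have hGc : Continuous G := by fun_prop
  have hGm : StrictMono G := by
    intro s t hst
    rcases le_or_gt 0 s with hs | hs
    · rw [hGF s hs, hGF t (hs.trans hst.le)]
      exact hmono hs (hs.trans hst.le) hst
    · refine add_lt_add_of_le_of_lt (hmono.monotoneOn (le_max_right s 0) (le_max_right t 0)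
        (max_le_max_right 0 hst.le)) ?_
      rw [min_eq_left hs.le]
      exact lt_min hst hs
  have htop : Tendsto G atTop atTop := by
    have h1 : Tendsto (fun t => A * exp (a * t)) atTop atTop :=
      (tendsto_exp_atTop.comp (tendsto_id.const_mul_atTop ha)).const_mul_atTop hA
    refine tendsto_atTop_mono' _ ?_ h1
    filter_upwards [eventually_ge_atTop 0] with t ht
    rw [hGF t ht]
    have := exp_pos (-(b * t))
    simp only [hF, twoExp]
    nlinarith [mul_pos hB this]
  have hbot : Tendsto G atBot atBot := by
    refine (tendsto_atBot_add_const_left atBot (F 0) tendsto_id).congr' ?_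
    filter_upwards [eventually_le_atBot 0] with t ht
    simp [hG, ht]
  have hsurj := hGc.surjective htop hbot
  let e : ℝ ≃o ℝ := hGm.orderIsoOfSurjective G hsurj
  have he : ∀ t, e t = G t := fun _ => rfl
  have hG0 : G 0 = A + B := by rw [hGF 0 le_rfl, hF, twoExp_zero]
  have hT0 : e.symm (A + B) = 0 := by rw [← hG0, ← he, e.symm_apply_apply]
  have hinv : ∀ x, A + B ≤ x → F (e.symm x) = x := fun x hx => by
    have h0 : 0 ≤ e.symm x := hT0 ▸ e.symm.monotone hx
    rw [← hGF _ h0, ← he, e.apply_symm_apply]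
  refine ⟨e.symm, e.symm.continuous, e.symm.strictMono, hT0, hinv, fun x hx => ?_⟩
  have hpos : 0 < e.symm x := hT0 ▸ e.symm.strictMono hx
  have hev : G =ᶠ[𝓝 (e.symm x)] F := by
    filter_upwards [lt_mem_nhds hpos] with t ht using hGF t ht.le
  have hd := (hasDerivAt_twoExp A B a b (e.symm x)).congr_of_eventuallyEq hev
  have hc : ContDiffAt ℝ (⊤ : ℕ∞) G (e.symm x) :=
    (contDiff_twoExp A B a b).contDiffAt.congr_of_eventuallyEq hev
  exact (e.toHomeomorph.toOpenPartialHomeomorph.contDiffAt_symm_deriv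
    (twoExp_deriv_pos hA ha hb h hpos).ne' (mem_univ x) hd hc).contDiffWithinAt

lemma twoExp_sub_quadratic_isBigO {A B a b : ℝ} (h : a * A = b * B) :
    (fun t => twoExp A B a b t - (A + B) - (a * A * (a + b) / 2) * t ^ 2)
      =O[𝓝 0] fun t => t ^ 3 := by
  have key : ∀ c : ℝ, (fun t => exp (c * t) - (1 + c * t + (c * t) ^ 2 / 2))
      =O[𝓝 0] fun t : ℝ => t ^ 3 := fun c => by
    have h0 : Tendsto (fun t : ℝ => c * t) (𝓝 0) (𝓝 0) := by
      simpa using (continuous_const_mul c).tendsto (0 : ℝ)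
    have h1 := (exp_sub_sum_range_isBigO_pow 3).comp_tendsto h0
    have h2 : (fun t : ℝ => (c * t) ^ 3) =O[𝓝 0] fun t : ℝ => t ^ 3 := by
      simp only [mul_pow]
      exact isBigO_const_mul_self _ _ _
    refine (h1.trans h2).congr_left fun t => ?_
    simp [Finset.sum_range_succ, Nat.factorial]
  refine (((key a).const_mul_left A).add ((key (-b)).const_mul_left B)).congr_left fun t => ?_
  simp only [twoExp, neg_mul]
  linear_combination (t ^ 2 * b / 2 - t) * h

/-- A right inverse of a function with a quadratic minimum has a square-root expansion. -/
lemma sqrt_expansion_of_quadratic {F T : ℝ → ℝ} {r k : ℝ} (hk : 0 < k)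
    (hF : (fun t => F t - r - k * t ^ 2) =O[𝓝 0] fun t => t ^ 3)
    (hT : Tendsto T (𝓝[>] r) (𝓝 0)) (hT0 : ∀ x, r < x → 0 ≤ T x)
    (hFT : ∀ x, r < x → F (T x) = x) :
    (fun x => T x - √(1 / k) * √(x - r)) =O[𝓝[>] r] fun x => x - r := by
  obtain ⟨C, hC, hb⟩ := (hF.comp_tendsto hT).exists_pos
  rw [IsBigOWith] at hb
  have hsmall : ∀ᶠ x in 𝓝[>] r, T x < k / (2 * C) := hT.eventually_lt_const (by positivity)
  refine IsBigO.of_bound (2 * C / k ^ 2) ?_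
  filter_upwards [hb, hsmall, self_mem_nhdsWithin] with x hx hs hr
  rw [mem_Ioi] at hr
  have h0 := hT0 x hr
  simp only [Function.comp_apply, hFT x hr, norm_eq_abs, abs_pow, abs_of_nonneg h0] at hx
  rw [norm_eq_abs, norm_eq_abs, abs_of_pos (sub_pos.2 hr), ← sqrt_mul (by positivity)]
  set w := √(1 / k * (x - r)) with hw
  have hw0 : 0 ≤ w := sqrt_nonneg _
  have hw2 : k * w ^ 2 = x - r := by
    rw [hw, sq_sqrt (mul_nonneg (by positivity) (sub_pos.2 hr).le)]
    field_simp
  have hwpos : 0 < w := by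
    refine hw0.lt_of_ne' fun h => ?_
    rw [h] at hw2
    linarith
  generalize T x = d at *
  rw [← hw2] at hx ⊢
  rw [lt_div_iff₀ (by positivity)] at hs
  have hd : d ^ 2 ≤ 2 * w ^ 2 := by
    have h1 := neg_le_of_abs_le hx
    have h2 : C * d ^ 3 ≤ k / 2 * d ^ 2 := by nlinarith [sq_nonneg d]
    nlinarith
  have hfac : k * (|d - w| * (d + w)) ≤ C * d ^ 3 := by
    calc k * (|d - w| * (d + w)) = |k * w ^ 2 - k * d ^ 2| := by
          rw [← abs_of_nonneg (add_nonneg h0 hw0), ← abs_mul, ← abs_of_pos hk, ← abs_mul,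
            abs_of_pos hk, abs_sub_comm]
          congr 1
          ring
      _ ≤ _ := hx
  have h3 : k * |d - w| ≤ C * d ^ 2 := by
    have hp : 0 < d + w := by positivity
    refine le_of_mul_le_mul_right ?_ hp
    nlinarith [mul_nonneg (mul_nonneg hC.le (sq_nonneg d)) hw0]
  have h4 : 2 * C / k ^ 2 * (k * w ^ 2) = 2 * C * w ^ 2 / k := by field_simp
  rw [h4, le_div_iff₀ hk]
  nlinarith

lemma log_expansion_of_twoExp {A B a b : ℝ} (hA : 0 < A) (hB : 0 < B) (ha : 0 < a) (hb : 0 < b)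
    {T : ℝ → ℝ} (hT0 : ∀ x, A + B ≤ x → 0 ≤ T x)
    (hT : ∀ x, A + B ≤ x → twoExp A B a b (T x) = x) :
    (fun x => T x - (log x - log A) / a) =O[atTop] fun x => x ^ (-(1 + b / a)) := by
  refine IsBigO.of_bound (B / A / a * (A + B) ^ (1 + b / a)) ?_
  filter_upwards [eventually_ge_atTop (A + B)] with x hx
  have hx0 : 0 < x := by linarith
  have h0 := hT0 x hx
  have h := hT x hx
  generalize T x = t at *
  have hab : 0 < 1 + b / a := by positivity
  have hx1 : x = A * exp (a * t) * (1 + B / A * exp (-((a + b) * t))) := by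
    rw [← h, twoExp, show -(b * t) = a * t + -((a + b) * t) by ring, exp_add]
    field_simp
  have hle : x ≤ (A + B) * exp (a * t) := by
    rw [← h, twoExp, add_mul]
    gcongr
    nlinarith [mul_nonneg ha.le h0, mul_nonneg hb.le h0]
  set E := exp (-((a + b) * t)) with hE
  have hE0 : 0 < B / A * E := by positivity
  have hlog : log x = log A + a * t + log (1 + B / A * E) := by
    conv_lhs => rw [hx1]
    rw [log_mul (by positivity) (by positivity), log_mul hA.ne' (exp_pos _).ne', log_exp]
  have hl0 : 0 ≤ log (1 + B / A * E) := log_nonneg (by linarith)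
  have hl1 : log (1 + B / A * E) ≤ B / A * E := by
    linarith [log_le_sub_one_of_pos (show 0 < 1 + B / A * E by linarith)]
  have hEx : E ≤ (A + B) ^ (1 + b / a) * x ^ (-(1 + b / a)) := by
    have h1 : x ^ (1 + b / a) ≤ (A + B) ^ (1 + b / a) * exp ((a + b) * t) := by
      calc x ^ (1 + b / a) ≤ ((A + B) * exp (a * t)) ^ (1 + b / a) :=
            rpow_le_rpow hx0.le hle hab.le
        _ = _ := by
            rw [mul_rpow (by positivity) (exp_pos _).le, ← exp_mul]
            congr 2
            field_simp
    rw [rpow_neg hx0.le, hE, exp_neg, ← div_eq_mul_inv, le_div_iff₀ (by positivity),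
      inv_mul_le_iff₀ (exp_pos _)]
    linarith
  rw [norm_eq_abs, norm_of_nonneg (by positivity), hlog,
    show t - (log A + a * t + log (1 + B / A * E) - log A) / a = -(log (1 + B / A * E) / a) by
      field_simp; ring,
    abs_neg, abs_of_nonneg (by positivity)]
  calc log (1 + B / A * E) / a ≤ B / A * ((A + B) ^ (1 + b / a) * x ^ (-(1 + b / a))) / a := by
        gcongr
        exact hl1.trans (by gcongr)
    _ = _ := by ring

lemma exp_sub_one_isBigO : (fun t : ℝ => exp t - 1) =O[𝓝 0] fun t => t :=
  (exp_sub_sum_range_isBigO_pow 1).congr (fun t => by simp) fun t => by simp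

lemma const_mul_exp_isBigO_atTop {T : ℝ → ℝ} {m L s q r : ℝ} (hm : 0 < m) (hr : 0 < r)
    (hT : (fun x => T x - (log x - L) / q) =O[atTop] fun x => x ^ (-r))
    (hL : log m = s * L / q) :
    (fun x => m * exp (s * T x) - x ^ (s / q)) =O[atTop] fun x => x ^ (s / q - r) := by
  have h1 : (fun x => s * (T x - (log x - L) / q)) =O[atTop] fun x => x ^ (-r) :=
    hT.const_mul_left s
  have h2 := (exp_sub_one_isBigO.comp_tendsto (h1.trans_tendsto (tendsto_rpow_neg_atTop hr))).trans h1
  refine ((isBigO_refl (fun x : ℝ => x ^ (s / q)) atTop).mul h2).congr' ?_ ?_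
  · filter_upwards [eventually_gt_atTop 0] with x hx
    simp only [Function.comp_apply]
    have : m * exp (s * T x) = x ^ (s / q) * exp (s * (T x - (log x - L) / q)) := by
      rw [rpow_def_of_pos hx, ← exp_add]
      nth_rw 1 [← exp_log hm]
      rw [← exp_add, hL]
      congr 1
      ring
    rw [this]
    ring
  · filter_upwards [eventually_gt_atTop 0] with x hx
    rw [← rpow_add hx, sub_eq_add_neg]

lemma const_mul_exp_isBigO_nhdsGT {T : ℝ → ℝ} {m s c r : ℝ}
    (hT0 : Tendsto T (𝓝[>] r) (𝓝 0))
    (hT : (fun x => T x - c * √(x - r)) =O[𝓝[>] r] fun x => x - r) :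
    (fun x => m * exp (s * T x) - (m + s * (m * c) * √(x - r))) =O[𝓝[>] r] fun x => x - r := by
  have hsq : (fun x : ℝ => √(x - r) * √(x - r)) =ᶠ[𝓝[>] r] fun x => x - r := by
    filter_upwards [self_mem_nhdsWithin] with x hx
    exact mul_self_sqrt (sub_pos.2 hx).le
  have hbd : (fun x : ℝ => √(x - r)) =O[𝓝[>] r] fun _ => (1 : ℝ) := by
    have hc : Continuous fun x : ℝ => √(x - r) := by fun_prop
    exact (hc.tendsto r).isBigO_one ℝ |>.mono nhdsWithin_le_nhds
  have h1 : (fun x => x - r) =O[𝓝[>] r] fun x => √(x - r) :=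
    ((isBigO_refl (fun x : ℝ => √(x - r)) _).mul hbd).congr' hsq (.of_forall fun _ => mul_one _)
  have h2 : T =O[𝓝[>] r] fun x => √(x - r) :=
    ((hT.trans h1).add (isBigO_const_mul_self c _ _)).congr_left fun x => by ring
  have h3 : (fun x => s * T x) =O[𝓝[>] r] fun x => √(x - r) := h2.const_mul_left s
  have h4 : Tendsto (fun x => s * T x) (𝓝[>] r) (𝓝 0) := by simpa using hT0.const_mul s
  have h5 := ((exp_sub_sum_range_isBigO_pow 2).comp_tendsto h4).trans (h3.pow 2)
  have h6 : (fun x => √(x - r) ^ 2) =ᶠ[𝓝[>] r] fun x => x - r :=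
    .trans (.of_forall fun x => sq _) hsq
  refine (((h5.trans_eventuallyEq h6).const_mul_left m).add
    (hT.const_mul_left (m * s))).congr_left fun x => ?_
  simp [Finset.sum_range_succ, Nat.factorial]
  ring

lemma Vfun_mul_exp {m : ℝ} (hm : 0 < m) (α x s : ℝ) :
    Vfun α x (m * exp s) =
      (m * exp s) ^ 2 * (x - twoExp (m ^ (2 * α)) (m ^ 2)⁻¹ (2 * α) 2 s) := by
  have he := exp_pos s
  have h1 : (m * exp s) ^ (2 * α + 2) = (m * exp s) ^ 2 * (m ^ (2 * α) * exp (2 * α * s)) := by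
    rw [rpow_add (by positivity), mul_rpow hm.le he.le, ← exp_mul, rpow_two, mul_comm s]
    ring
  have h2 : exp (-(2 * s)) = (exp s ^ 2)⁻¹ := by
    rw [exp_neg, ← exp_nat_mul]
    norm_num
  rw [Vfun, twoExp, h1, h2]
  field_simp
  ring

lemma Vfun_mul_exp_eq_zero_iff {m : ℝ} (hm : 0 < m) (α x s : ℝ) :
    Vfun α x (m * exp s) = 0 ↔ twoExp (m ^ (2 * α)) (m ^ 2)⁻¹ (2 * α) 2 s = x := by
  rw [Vfun_mul_exp hm, mul_eq_zero, sub_eq_zero, eq_comm (a := x), or_iff_right]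
  positivity

lemma ustar_pos {α : ℝ} (hα : 0 < α) : 0 < ustar α := rpow_pos_of_pos hα _

lemma ustar_sq {α : ℝ} (hα : 0 < α) : ustar α ^ 2 = α ^ (-(1 / (α + 1))) := by
  rw [ustar, ← rpow_two, ← rpow_mul hα.le]
  congr 1
  field_simp
  ring

lemma mul_ustar_rpow {α : ℝ} (hα : 0 < α) : α * ustar α ^ (2 * α) = (ustar α ^ 2)⁻¹ := by
  rw [ustar_sq hα, ← rpow_neg hα.le, ustar, ← rpow_mul hα.le]
  nth_rw 1 [← rpow_one α]
  rw [← rpow_add hα]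
  congr 1
  field_simp
  ring

lemma ustar_rpow_add {α : ℝ} (hα : 0 < α) :
    ustar α ^ (2 * α) + (ustar α ^ 2)⁻¹ = rhoC α := by
  have h := mul_ustar_rpow hα
  have h1 : (ustar α ^ 2)⁻¹ = α ^ (1 / (α + 1)) := by
    rw [ustar_sq hα, ← rpow_neg hα.le, neg_neg]
  rw [rhoC, ← h1, ← h]
  field_simp
  ring

lemma one_lt_rhoC {α : ℝ} (hα : 1 < α) : 1 < rhoC α := by
  have h1 : 1 < (α + 1) / α := by rw [lt_div_iff₀ (by linarith)]; linarith
  have h2 : 1 < α ^ (1 / (α + 1)) := one_lt_rpow hα (by positivity)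
  exact one_lt_mul_of_lt_of_le h1 h2.le

theorem statement5 (α : ℝ) (hα : 1 < α) :
    -- ρ ∈ (1,2]
    (1 < rhoC α ∧ rhoC α ≤ 2) ∧
    -- for x > ρ exactly two positive roots, on either side of u*
    (∀ x : ℝ, rhoC α < x → ∃ r1 r2 : ℝ, 0 < r1 ∧ r1 < ustar α ∧ ustar α < r2 ∧
      {u : ℝ | 0 < u ∧ Vfun α x u = 0} = {r1, r2}) ∧
    -- for x = ρ the unique positive root u*
    ({u : ℝ | 0 < u ∧ Vfun α (rhoC α) u = 0} = {ustar α}) ∧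
    -- for 0 ≤ x < ρ no positive roots
    (∀ x : ℝ, 0 ≤ x → x < rhoC α → {u : ℝ | 0 < u ∧ Vfun α x u = 0} = ∅) ∧
    -- the two root branches u₁, u₂ on [ρ,∞)
    ∃ u1 u2 : ℝ → ℝ,
      (∀ x : ℝ, rhoC α ≤ x → Vfun α x (u1 x) = 0 ∧ Vfun α x (u2 x) = 0 ∧
        0 < u1 x ∧ u1 x ≤ ustar α ∧ ustar α ≤ u2 x) ∧
      -- (1) continuity
      ContinuousOn u1 (Set.Ici (rhoC α)) ∧ ContinuousOn u2 (Set.Ici (rhoC α)) ∧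
      -- (2) smoothness on (ρ,∞)
      ContDiffOn ℝ (⊤ : ℕ∞) u1 (Set.Ioi (rhoC α)) ∧
      ContDiffOn ℝ (⊤ : ℕ∞) u2 (Set.Ioi (rhoC α)) ∧
      -- (3) strict monotonicity
      StrictAntiOn u1 (Set.Ici (rhoC α)) ∧ StrictMonoOn u2 (Set.Ici (rhoC α)) ∧
      -- (4) asymptotics at +∞
      (fun x => u1 x - x ^ (-(1/2) : ℝ)) =O[atTop] (fun x => x ^ (-(3/2) - α)) ∧
      (fun x => u2 x - x ^ (1 / (2 * α))) =O[atTop] (fun x => x ^ (-(1 / (2 * α)) - 1)) ∧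
      -- (5) expansions at ρ⁺
      (fun x => u1 x - (ustar α - c1C α * Real.sqrt (x - rhoC α)))
        =O[𝓝[>] (rhoC α)] (fun x => x - rhoC α) ∧
      (fun x => u2 x - (ustar α + c1C α * Real.sqrt (x - rhoC α)))
        =O[𝓝[>] (rhoC α)] (fun x => x - rhoC α) := by
  have hα0 : 0 < α := by linarith
  set m := ustar α with hm_def
  have hm : 0 < m := ustar_pos hα0
  have hrel := mul_ustar_rpow hα0
  have hsum := ustar_rpow_add hα0
  have hV := Vfun_mul_exp_eq_zero_iff hm α
  rw [← hm_def] at hrel hsum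
  set A := m ^ (2 * α) with hA_def
  set B := (m ^ 2)⁻¹ with hB_def
  set r := rhoC α
  have hA : 0 < A := by positivity
  have hB : 0 < B := by positivity
  have h2 : 2 * α * A = 2 * B := by linarith
  have hsum' : B + A = r := by linarith
  have hmono1 := strictMonoOn_twoExp hB two_pos (by positivity) h2.symm
  have hmono2 := strictMonoOn_twoExp hA (by positivity) two_pos h2
  obtain ⟨T1, hc1, hm1, h01, hT1, hs1⟩ :=
    exists_twoExp_inverse hB hA two_pos (by positivity) h2.symm
  obtain ⟨T2, hc2, hm2, h02, hT2, hs2⟩ :=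
    exists_twoExp_inverse hA hB (by positivity) two_pos h2
  have hp1 : ∀ x, B + A ≤ x → 0 ≤ T1 x := fun x hx => h01 ▸ hm1.monotone hx
  have hp2 : ∀ x, A + B ≤ x → 0 ≤ T2 x := fun x hx => h02 ▸ hm2.monotone hx
  have hlogA : log A = 2 * α * log m := log_rpow hm _
  have hlogB : log B = -(2 * log m) := by rw [hB_def, log_inv, log_pow]; norm_num
  have hi1 := log_expansion_of_twoExp hB hA two_pos (by positivity) hp1 hT1
  have hi2 := log_expansion_of_twoExp hA hB (by positivity) two_pos hp2 hT2
  have hl1 : Tendsto T1 (𝓝[>] (B + A)) (𝓝 0) :=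
    (h01 ▸ hc1.tendsto (B + A)).mono_left nhdsWithin_le_nhds
  have hl2 : Tendsto T2 (𝓝[>] (A + B)) (𝓝 0) :=
    (h02 ▸ hc2.tendsto (A + B)).mono_left nhdsWithin_le_nhds
  have he1 := sqrt_expansion_of_quadratic (by positivity)
    (twoExp_sub_quadratic_isBigO h2.symm) hl1 (fun x hx => hp1 x (le_of_lt hx))
    (fun x hx => hT1 x (le_of_lt hx))
  have he2 := sqrt_expansion_of_quadratic (by positivity)
    (twoExp_sub_quadratic_isBigO h2) hl2 (fun x hx => hp2 x (le_of_lt hx))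
    (fun x hx => hT2 x (le_of_lt hx))
  have hc1C : m * √(1 / (2 * B * (2 + 2 * α) / 2)) = c1C α := by
    rw [c1C, ← ustar_sq hα0, ← hm_def, hB_def,
      show 1 / (2 * (m ^ 2)⁻¹ * (2 + 2 * α) / 2) = m ^ 2 / (2 * α + 2) by field_simp; ring,
      sqrt_div (sq_nonneg m), sqrt_sq hm.le]
    ring
  have hc2C : m * √(1 / (2 * α * A * (2 * α + 2) / 2)) = c1C α := by
    rw [← hc1C, h2, add_comm (2 * α)]
  have hx1 := const_mul_exp_isBigO_nhdsGT (m := m) (s := -1) hl1 he1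
  have hx2 := const_mul_exp_isBigO_nhdsGT (m := m) (s := 1) hl2 he2
  rw [hc1C] at hx1
  rw [hc2C] at hx2
  rw [hsum] at h02 hT2 hs2 hp2 hl2 hx2
  rw [hsum'] at h01 hT1 hs1 hp1 hl1 hx1
  have hroot : ∀ x u, 0 < u → Vfun α x u = 0 → r ≤ x ∧
      (u = m * exp (-T1 x) ∨ u = m * exp (T2 x)) := by
    intro x u hu h0
    obtain ⟨s, rfl⟩ : ∃ s, u = m * exp s :=
      ⟨log (u / m), by rw [exp_log (by positivity)]; field_simp⟩
    rw [hV] at h0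
    rcases le_total 0 s with hs | hs
    · have hrx : r ≤ x := by
        have := hmono2.monotoneOn self_mem_Ici hs hs
        rwa [twoExp_zero, h0, hsum] at this
      refine ⟨hrx, Or.inr ?_⟩
      rw [hmono2.injOn hs (hp2 x hrx) (h0.trans (hT2 x hrx).symm)]
    · rw [← neg_neg s, twoExp_neg] at h0
      have hs' : 0 ≤ -s := neg_nonneg.2 hs
      have hrx : r ≤ x := by
        have := hmono1.monotoneOn self_mem_Ici hs' hs'
        rwa [twoExp_zero, h0, hsum'] at this
      refine ⟨hrx, Or.inl ?_⟩
      rw [← hmono1.injOn hs' (hp1 x hrx) (h0.trans (hT1 x hrx).symm), neg_neg]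
  have hV1 : ∀ x, r ≤ x → Vfun α x (m * exp (-T1 x)) = 0 := fun x hx => by
    rw [hV, twoExp_neg, hT1 x hx]
  have hV2 : ∀ x, r ≤ x → Vfun α x (m * exp (T2 x)) = 0 := fun x hx => by
    rw [hV, hT2 x hx]
  have hset : ∀ x, r ≤ x →
      {u : ℝ | 0 < u ∧ Vfun α x u = 0} = {m * exp (-T1 x), m * exp (T2 x)} := by
    intro x hx
    ext u
    simp only [mem_ofPred_eq, mem_insert_iff, mem_singleton_iff]
    refine ⟨fun h => (hroot x u h.1 h.2).2, ?_⟩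
    rintro (rfl | rfl)
    · exact ⟨by positivity, hV1 x hx⟩
    · exact ⟨by positivity, hV2 x hx⟩
  refine ⟨⟨one_lt_rhoC hα, (hroot 2 1 one_pos (by norm_num [Vfun])).1⟩, fun x hx => ?_, ?_,
    fun x _ hx => ?_, fun x => m * exp (-T1 x), fun x => m * exp (T2 x), fun x hx => ?_,
    by fun_prop, by fun_prop, ?_, ?_, ?_, ?_, ?_, ?_, ?_, ?_⟩
  · have hp1x : 0 < T1 x := h01 ▸ hm1 hx
    have hp2x : 0 < T2 x := h02 ▸ hm2 hx
    refine ⟨_, _, by positivity, ?_, ?_, hset x hx.le⟩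
    · exact mul_lt_of_lt_one_right hm (exp_lt_one_iff.2 (neg_lt_zero.2 hp1x))
    · exact lt_mul_of_one_lt_right hm (one_lt_exp_iff.2 hp2x)
  · rw [hset r le_rfl, h01, h02]
    simp
  · refine eq_empty_of_forall_notMem fun u hu => ?_
    exact hx.not_ge (hroot x u hu.1 hu.2).1
  · refine ⟨hV1 x hx, hV2 x hx, by positivity, ?_, ?_⟩
    · exact mul_le_of_le_one_right hm.le (exp_le_one_iff.2 (neg_nonpos.2 (hp1 x hx)))
    · exact le_mul_of_one_le_right hm.le (one_le_exp (hp2 x hx))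
  · exact contDiffOn_const.mul hs1.neg.exp
  · exact contDiffOn_const.mul hs2.exp
  · intro x _ y _ hxy
    exact mul_lt_mul_of_pos_left (exp_lt_exp.2 (neg_lt_neg (hm1 hxy))) hm
  · intro x _ y _ hxy
    exact mul_lt_mul_of_pos_left (exp_lt_exp.2 (hm2 hxy)) hm
  · have := const_mul_exp_isBigO_atTop (s := -1) hm (by positivity) hi1
      (by rw [hlogB]; ring)
    convert this using 3 with x x
    · ring_nf
    · norm_num
    · ring
  · have := const_mul_exp_isBigO_atTop (s := 1) hm (by positivity) hi2
      (by rw [hlogA]; field_simp)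
    convert this using 3 with x x
    · ring_nf
    · field_simp
      ring
  · refine hx1.congr_left fun x => ?_
    ring_nf
  · refine hx2.congr_left fun x => ?_
    ring_nf
end
end

section
/- Let α > 1 and let τ(ξ) = 2(1+α)·S(ρξ) where S is the WKB integral associated to V(u;x) = xu² − u^{2α+2} − 1. Then: (i) τ : [0,∞) → [0,∞) is continuous and τ(ξ) = 0 for ξ ∈ [0,1]; (ii) τ restricted to [1,∞) is smooth; (iii) τ(ξ) = −2 + 𝕂₁[τ](ξ) for all ξ ≥ 1, and the Euler derivative satisfies Dτ(ξ) = 𝕂₁[Dτ](ξ) for all ξ ≥ 1. -/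
open Real MeasureTheory Set Filter Topology Asymptotics

noncomputable section

/-- The kernel `K_α`. -/
def Ka (α x : ℝ) : ℝ :=
  (Real.sin (2 * π / (1 + α)) / π) *
    (x / (1 + x ^ 2 - 2 * x * Real.cos (2 * π / (1 + α))))

/-- The convolution operator 𝕂_J. -/
def Kconv (α : ℝ) (J : Set ℝ) (f : ℝ → ℝ) (x : ℝ) : ℝ :=
  ∫ y in J, Ka α (x / y) * f y / y

/-- The Euler operator D = x d/dx, with the derivative taken within a set. -/
def eulerDW (s : Set ℝ) (f : ℝ → ℝ) : ℝ → ℝ := fun x => x * derivWithin f s x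

/-- The smaller positive root u₁(x) of V(·;x). -/
def u1F (α x : ℝ) : ℝ := sInf {u : ℝ | 0 < u ∧ Vfun α x u = 0}

/-- The larger positive root u₂(x) of V(·;x). -/
def u2F (α x : ℝ) : ℝ := sSup {u : ℝ | 0 < u ∧ Vfun α x u = 0}

/-- The WKB integral S(x). -/
def Sfun (α x : ℝ) : ℝ :=
  if rhoC α < x then (1/π) * ∫ u in u1F α x..u2F α x, Real.sqrt (Vfun α x u) / u else 0

/-- τ(ξ) = 2(1+α)·S(ρξ). -/
def tauF (α ξ : ℝ) : ℝ := 2 * (1 + α) * Sfun α (rhoC α * ξ)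

/-- The opening angle `2π/(1+α)`. -/
def angleA (α : ℝ) : ℝ := 2 * π / (1 + α)

/-- `x - e^{αw} - e^{-w}`, the potential in the logarithmic coordinate `w = 2 log u`, divided by
`e^w`. -/
def potC (α x : ℝ) (w : ℂ) : ℂ := x - Complex.exp (α * w) - Complex.exp (-w)

/-- The WKB integrand `√(x e^w - e^{(α+1)w} - 1)` in the logarithmic coordinate. -/
def wkbC (α x : ℝ) (w : ℂ) : ℂ := Complex.exp (w / 2) * potC α x w ^ (2⁻¹ : ℂ)

lemma angleA_pos {α : ℝ} (hα : 1 < α) : 0 < angleA α := by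
  unfold angleA; positivity

lemma angleA_lt_pi {α : ℝ} (hα : 1 < α) : angleA α < π := by
  unfold angleA
  rw [div_lt_iff₀ (by linarith)]
  nlinarith [pi_pos]

lemma add_one_mul_angleA {α : ℝ} (hα : 1 < α) : (α + 1) * angleA α = 2 * π := by
  unfold angleA
  have : 1 + α ≠ 0 := by linarith
  field_simp
  ring

lemma mul_angleA {α : ℝ} (hα : 1 < α) : α * angleA α = 2 * π - angleA α := by
  linarith [add_one_mul_angleA hα]

lemma potC_re (α x W ψ : ℝ) : (potC α x (W + ψ * Complex.I)).re =
    x - exp (α * W) * cos (α * ψ) - exp (-W) * cos ψ := by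
  simp [potC, Complex.exp_re]

lemma potC_im (α x W ψ : ℝ) : (potC α x (W + ψ * Complex.I)).im =
    exp (-W) * sin ψ - exp (α * W) * sin (α * ψ) := by
  simp [potC, Complex.exp_im]
  ring

/-- The minimiser of `e^{αW} + e^{-W}`. -/
def critW (α : ℝ) : ℝ := -(Real.log α / (α + 1))

lemma exp_neg_critW {α : ℝ} (hα : 1 < α) : exp (-critW α) = rhoC α * α / (α + 1) := by
  unfold critW rhoC
  rw [Real.rpow_def_of_pos (by linarith)]
  have h1 : α + 1 ≠ 0 := by linarith
  have h2 : α ≠ 0 := by linarith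
  field_simp

lemma exp_mul_critW {α : ℝ} (hα : 1 < α) : exp (α * critW α) = rhoC α / (α + 1) := by
  have h2 : α ≠ 0 := by linarith
  have h1 : α + 1 ≠ 0 := by linarith
  have h : exp (α * critW α) = exp (-critW α) * exp (-Real.log α) := by
    rw [← Real.exp_add]
    congr 1
    unfold critW
    field_simp
    ring
  rw [h, exp_neg_critW hα, Real.exp_neg, Real.exp_log (by linarith)]
  field_simp

lemma rhoC_pos {α : ℝ} (hα : 1 < α) : 0 < rhoC α := by
  unfold rhoC
  have : 0 < α := by linarith
  positivity

lemma rhoC_le_exp_add_exp {α : ℝ} (hα : 1 < α) (W : ℝ) :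
    rhoC α ≤ exp (α * W) + exp (-W) := by
  have h1 : exp (α * W) = rhoC α / (α + 1) * exp (α * (W - critW α)) := by
    rw [← exp_mul_critW hα, ← Real.exp_add]; ring_nf
  have h2 : exp (-W) = rhoC α * α / (α + 1) * exp (-(W - critW α)) := by
    rw [← exp_neg_critW hα, ← Real.exp_add]; ring_nf
  have hp := rhoC_pos hα
  have h3 := Real.add_one_le_exp (α * (W - critW α))
  have h4 := Real.add_one_le_exp (-(W - critW α))
  have hq : 0 < rhoC α / (α + 1) := by positivity
  have hq' : 0 < rhoC α * α / (α + 1) := by positivity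
  have h5 := mul_le_mul_of_nonneg_left h3 hq.le
  have h6 := mul_le_mul_of_nonneg_left h4 hq'.le
  rw [h1, h2]
  have : rhoC α = rhoC α / (α + 1) * (α * (W - critW α) + 1) +
      rhoC α * α / (α + 1) * (-(W - critW α) + 1) := by
    field_simp
    ring
  linarith

lemma mul_sin_lt_sin_mul {c z : ℝ} (hc : 0 < c) (hc' : c < 1) (hz : 0 < z) (hz' : z ≤ π) :
    c * sin z < sin (c * z) := by
  have := strictConcaveOn_sin_Icc.2 (x := z) ⟨hz.le, hz'⟩ (y := 0) ⟨le_rfl, pi_pos.le⟩ hz.ne'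
    hc (sub_pos.2 hc') (by ring)
  simpa using this

lemma potC_mem_slitPlane {α x : ℝ} (hα : 1 < α) (hx : rhoC α ≤ x) (W : ℝ) {ψ : ℝ} (h0 : 0 < ψ)
    (h1 : ψ ≤ angleA α) : potC α x (W + ψ * Complex.I) ∈ Complex.slitPlane := by
  rw [Complex.mem_slitPlane_iff, or_iff_not_imp_right]
  intro him
  push Not at him
  rw [potC_im] at him
  rw [potC_re]
  by_contra! hre
  have hθ := angleA_lt_pi hα
  have hsin : 0 < sin ψ := sin_pos_of_pos_of_lt_pi h0 (by linarith)
  have hsa : 0 < sin (α * ψ) := by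
    have : 0 < exp (α * W) * sin (α * ψ) := by
      have : 0 < exp (-W) * sin ψ := by positivity
      linarith
    exact pos_of_mul_pos_right this (exp_pos _).le
  set y := exp (α * W) * cos (α * ψ) + exp (-W) * cos ψ with hy
  have hρ := rhoC_pos hα
  have hy' : rhoC α ≤ y := by linarith
  have hadd : sin ((α + 1) * ψ) = sin (α * ψ) * cos ψ + cos (α * ψ) * sin ψ := by
    rw [← sin_add]; ring_nf
  have e1 : y * sin (α * ψ) = exp (-W) * sin ((α + 1) * ψ) := by
    rw [hadd, hy]; linear_combination (-cos (α * ψ)) * him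
  have e2 : y * sin ψ = exp (α * W) * sin ((α + 1) * ψ) := by
    rw [hadd, hy]; linear_combination (cos ψ) * him
  have hpos : 0 < sin ((α + 1) * ψ) := by
    have : 0 < exp (-W) * sin ((α + 1) * ψ) := by
      rw [← e1]; have : 0 < y := by linarith
      positivity
    exact pos_of_mul_pos_right this (exp_pos _).le
  have hlt : (α + 1) * ψ ≤ π := by
    by_contra! hcon
    have h2 : (α + 1) * ψ ≤ 2 * π := by
      rw [← add_one_mul_angleA hα]; gcongr
    have := sin_nonneg_of_nonneg_of_le_pi (x := (α + 1) * ψ - π) (by linarith) (by linarith)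
    rw [sin_sub_pi] at this
    linarith
  have hap : 0 < α + 1 := by linarith
  have s1 : 1 / (α + 1) * sin ((α + 1) * ψ) < sin ψ := by
    have := mul_sin_lt_sin_mul (c := 1 / (α + 1)) (by positivity)
      (by rw [div_lt_one hap]; linarith) (by positivity) hlt
    have e : 1 / (α + 1) * ((α + 1) * ψ) = ψ := by field_simp
    rwa [e] at this
  have s2 : α / (α + 1) * sin ((α + 1) * ψ) < sin (α * ψ) := by
    have := mul_sin_lt_sin_mul (c := α / (α + 1)) (by positivity)
      (by rw [div_lt_one hap]; linarith) (by positivity) hlt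
    have e : α / (α + 1) * ((α + 1) * ψ) = α * ψ := by field_simp
    rwa [e] at this
  have t1 : exp (α * critW α) < exp (α * W) := by
    rw [exp_mul_critW hα]
    refine lt_of_mul_lt_mul_right ?_ hpos.le
    rw [← e2]
    calc rhoC α / (α + 1) * sin ((α + 1) * ψ)
        = rhoC α * (1 / (α + 1) * sin ((α + 1) * ψ)) := by ring
      _ < rhoC α * sin ψ := by gcongr
      _ ≤ y * sin ψ := by gcongr
  have t2 : exp (-critW α) < exp (-W) := by
    rw [exp_neg_critW hα]
    refine lt_of_mul_lt_mul_right ?_ hpos.le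
    rw [← e1]
    calc rhoC α * α / (α + 1) * sin ((α + 1) * ψ)
        = rhoC α * (α / (α + 1) * sin ((α + 1) * ψ)) := by ring
      _ < rhoC α * sin (α * ψ) := by gcongr
      _ ≤ y * sin (α * ψ) := by gcongr
  rw [Real.exp_lt_exp] at t1 t2
  have : critW α < W := lt_of_mul_lt_mul_left t1 (by linarith)
  linarith

lemma cpow_inv_two_re_nonneg (z : ℂ) : 0 ≤ (z ^ (2⁻¹ : ℂ)).re := by
  rw [Complex.cpow_inv_two_re]; positivity

lemma cpow_inv_two_im_nonneg {z : ℂ} (hz : 0 ≤ z.im) : 0 ≤ (z ^ (2⁻¹ : ℂ)).im := by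
  rw [Complex.cpow_inv_two_im_eq_sqrt hz]; positivity

lemma cpow_inv_two_im_nonpos {z : ℂ} (hz : z.im < 0) : (z ^ (2⁻¹ : ℂ)).im ≤ 0 := by
  rw [Complex.cpow_inv_two_im_eq_neg_sqrt hz]; exact neg_nonpos.2 (Real.sqrt_nonneg _)

lemma cpow_inv_two_sq (z : ℂ) : (z ^ (2⁻¹ : ℂ)) ^ 2 = z :=
  Complex.cpow_ofNat_inv_pow z 2

/-- A stable comparison of two square roots lying on the same side of the origin. -/
lemma mul_norm_sub_le {A B : ℂ} {c : ℝ}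
    (h : (0 ≤ A.re ∧ c * ‖B‖ ≤ B.re) ∨ (0 ≤ A.im ∧ c * ‖B‖ ≤ B.im) ∨
      (A.im ≤ 0 ∧ c * ‖B‖ ≤ -B.im)) :
    c * ‖B‖ * ‖A - B‖ ≤ ‖A ^ 2 - B ^ 2‖ := by
  have h1 : c * ‖B‖ ≤ ‖A + B‖ := by
    rcases h with ⟨h1, h2⟩ | ⟨h1, h2⟩ | ⟨h1, h2⟩
    · have := Complex.re_le_norm (A + B)
      simp only [Complex.add_re] at this
      linarith
    · have := (le_abs_self _).trans (Complex.abs_im_le_norm (A + B))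
      simp only [Complex.add_im] at this
      linarith
    · have := (neg_le_abs _).trans (Complex.abs_im_le_norm (A + B))
      simp only [Complex.add_im] at this
      linarith
  rw [sq_sub_sq, norm_mul]
  gcongr

/-- The integrand with its leading behaviour at `+∞` removed. -/
def wkbReg (α x : ℝ) (w : ℂ) : ℂ :=
  wkbC α x w + Complex.I * Complex.exp ((α + 1) * w / 2)

lemma min_sin_le {a b y : ℝ} (ha : 0 ≤ a) (hb : b ≤ π) (h1 : a ≤ y) (h2 : y ≤ b) :
    min (sin a) (sin b) ≤ sin y :=
  strictConcaveOn_sin_Icc.concaveOn.min_le_of_mem_Icc ⟨ha, by linarith⟩ ⟨by linarith, hb⟩ ⟨h1, h2⟩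

lemma norm_wkbReg_right_le {α : ℝ} (hα : 1 < α) (x : ℝ) : ∃ C : ℝ, ∀ L ψ : ℝ, 0 ≤ L → 0 < ψ →
    ψ ≤ angleA α → ‖wkbReg α x (L + ψ * Complex.I)‖ ≤ C * exp (-((α - 1) / 2 * L)) := by
  have hθ0 := angleA_pos hα
  have hθ := angleA_lt_pi hα
  set c := min (sin (π / 4)) (sin (angleA α / 2)) with hc
  have hcpos : 0 < c := by
    refine lt_min ?_ (sin_pos_of_pos_of_lt_pi (by linarith) (by linarith))
    exact sin_pos_of_pos_of_lt_pi (by positivity) (by linarith [pi_pos])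
  refine ⟨(|x| + 1) / c, fun L ψ hL h0 h1 => ?_⟩
  set w : ℂ := L + ψ * Complex.I with hw
  set A := potC α x w ^ (2⁻¹ : ℂ) with hA
  set B := -Complex.I * Complex.exp (α * w / 2) with hB
  have hre : (α * w / 2 : ℂ).re = α * L / 2 := by simp [hw]
  have him : (α * w / 2 : ℂ).im = α * ψ / 2 := by simp [hw]
  have hnB : ‖B‖ = exp (α * L / 2) := by
    rw [hB, norm_mul, Complex.norm_exp, hre]; simp
  have hBre : B.re = ‖B‖ * sin (α * ψ / 2) := by
    rw [hnB, hB]; simp [Complex.exp_re, Complex.exp_im, hw]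
  have hBim : B.im = -(‖B‖ * cos (α * ψ / 2)) := by
    rw [hnB, hB]; simp [Complex.exp_re, Complex.exp_im, hw]
  have hψ0 : 0 < α * ψ := by positivity
  have hmul : α * ψ ≤ 2 * π - angleA α := by
    rw [← mul_angleA hα]; gcongr
  have key : c * ‖B‖ * ‖A - B‖ ≤ ‖A ^ 2 - B ^ 2‖ := by
    apply mul_norm_sub_le
    rcases le_or_gt (α * ψ) (π / 2) with h | h
    · refine Or.inr (Or.inr ⟨?_, ?_⟩)
      · have hV : (potC α x w).im ≤ 0 := by
          rw [hw, potC_im]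
          have e1 : exp (-L) ≤ exp (α * L) := by
            apply Real.exp_le_exp.2; nlinarith
          have e2 : sin ψ ≤ sin (α * ψ) :=
            sin_le_sin_of_le_of_le_pi_div_two (by linarith) h (by nlinarith)
          have e3 : 0 ≤ sin ψ := (sin_pos_of_pos_of_lt_pi h0 (by linarith)).le
          have := mul_le_mul e1 e2 e3 (exp_pos _).le
          linarith
        rcases hV.lt_or_eq with hV | hV
        · exact cpow_inv_two_im_nonpos hV
        · exfalso
          rw [hw, potC_im] at hV
          have e1 : exp (-L) ≤ exp (α * L) := by
            apply Real.exp_le_exp.2; nlinarith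
          have e2 : sin ψ < sin (α * ψ) :=
            sin_lt_sin_of_lt_of_le_pi_div_two (by linarith) h (by nlinarith)
          have e3 : 0 < sin ψ := sin_pos_of_pos_of_lt_pi h0 (by linarith)
          have := mul_lt_mul' e1 e2 e3.le (exp_pos _)
          linarith
      · rw [hBim, neg_neg, mul_comm]
        gcongr
        calc c ≤ sin (π / 4) := min_le_left _ _
          _ = cos (π / 4) := by rw [sin_pi_div_four, cos_pi_div_four]
          _ ≤ cos (α * ψ / 2) :=
            cos_le_cos_of_nonneg_of_le_pi (by linarith) (by linarith [pi_pos]) (by linarith)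
    · refine Or.inl ⟨cpow_inv_two_re_nonneg _, ?_⟩
      rw [hBre, mul_comm]
      gcongr
      have := min_sin_le (a := π / 4) (b := π - angleA α / 2) (y := α * ψ / 2) (by positivity)
        (by linarith) (by linarith) (by linarith)
      rwa [sin_pi_sub] at this
  have hsq : A ^ 2 - B ^ 2 = x - Complex.exp (-w) := by
    rw [hA, cpow_inv_two_sq, hB, mul_pow, neg_sq, Complex.I_sq, ← Complex.exp_nat_mul, potC]
    push_cast
    ring_nf
  have hbd : ‖A ^ 2 - B ^ 2‖ ≤ |x| + 1 := by
    rw [hsq]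
    refine (norm_sub_le _ _).trans ?_
    rw [Complex.norm_exp]
    have : (-w).re = -L := by simp [hw]
    rw [this, Complex.norm_real, Real.norm_eq_abs]
    gcongr
    rw [Real.exp_le_one_iff]; linarith
  have hreg : wkbReg α x w = Complex.exp (w / 2) * (A - B) := by
    rw [wkbReg, wkbC, mul_sub, hB]
    have : Complex.exp ((α + 1) * w / 2) = Complex.exp (w / 2) * Complex.exp (α * w / 2) := by
      rw [← Complex.exp_add]; ring_nf
    rw [this]
    ring
  have hn2 : ‖Complex.exp (w / 2)‖ = exp (L / 2) := by
    rw [Complex.norm_exp]; simp [hw]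
  rw [hreg, norm_mul, hn2]
  have h3 : c * exp (α * L / 2) * ‖A - B‖ ≤ |x| + 1 := by
    rw [← hnB]; exact key.trans hbd
  have h4 : ‖A - B‖ ≤ (|x| + 1) / c * exp (-(α * L / 2)) := by
    rw [Real.exp_neg, ← div_eq_mul_inv, div_div, le_div_iff₀ (by positivity)]
    linarith
  calc exp (L / 2) * ‖A - B‖ ≤ exp (L / 2) * ((|x| + 1) / c * exp (-(α * L / 2))) := by gcongr
    _ = (|x| + 1) / c * (exp (L / 2) * exp (-(α * L / 2))) := by ring
    _ = _ := by rw [← Real.exp_add]; ring_nf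

lemma norm_wkbReg_left_le {α : ℝ} (hα : 1 < α) (x : ℝ) : ∃ C L₀ : ℝ, ∀ L ψ : ℝ, L₀ ≤ L → 0 < ψ →
    ψ ≤ angleA α → ‖wkbReg α x (((-L : ℝ) : ℂ) + ψ * Complex.I) - Complex.I‖ ≤ C * exp (-L) := by
  have hθ0 := angleA_pos hα
  have hθ := angleA_lt_pi hα
  have hsθ : 0 < sin (angleA α) := sin_pos_of_pos_of_lt_pi hθ0 hθ
  set c := cos (angleA α / 2) with hc
  have hcpos : 0 < c := cos_pos_of_mem_Ioo ⟨by linarith, by linarith⟩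
  refine ⟨(|x| + 1) / c + 1, α * angleA α / sin (angleA α), fun L ψ hL' h0 h1 => ?_⟩
  have hL : 0 ≤ L := le_trans (by positivity) hL'
  set w : ℂ := ((-L : ℝ) : ℂ) + ψ * Complex.I with hw
  set A := potC α x w ^ (2⁻¹ : ℂ) with hA
  set B := Complex.I * Complex.exp (-w / 2) with hB
  have hnB : ‖B‖ = exp (L / 2) := by
    rw [hB, norm_mul, Complex.norm_exp]; simp [hw]
  have hBim : B.im = ‖B‖ * cos (ψ / 2) := by
    rw [hnB, hB]; simp [Complex.exp_re, Complex.exp_im, hw, neg_div]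
  have key : c * ‖B‖ * ‖A - B‖ ≤ ‖A ^ 2 - B ^ 2‖ := by
    apply mul_norm_sub_le
    refine Or.inr (Or.inl ⟨cpow_inv_two_im_nonneg ?_, ?_⟩)
    · rw [hw, potC_im, neg_neg]
      have e1 : sin (α * ψ) ≤ α * ψ := sin_le (by positivity)
      have e2 : ψ / angleA α * sin (angleA α) ≤ sin ψ := by
        rcases h1.eq_or_lt with h | h
        · rw [h, div_self hθ0.ne', one_mul]
        · have := (mul_sin_lt_sin_mul (c := ψ / angleA α) (by positivity)
            (by rwa [div_lt_one hθ0]) hθ0 hθ.le).le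
          rwa [div_mul_cancel₀ _ hθ0.ne'] at this
      have e3 : α * angleA α / sin (angleA α) ≤ exp L := by
        linarith [Real.add_one_le_exp L]
      have e4 : exp (α * -L) ≤ 1 := by rw [Real.exp_le_one_iff]; nlinarith
      have e5 : α * ψ ≤ exp L * sin ψ := by
        calc α * ψ = α * angleA α / sin (angleA α) * (ψ / angleA α * sin (angleA α)) := by
              field_simp
          _ ≤ exp L * sin ψ := by gcongr
      have e6 : exp (α * -L) * sin (α * ψ) ≤ 1 * (α * ψ) :=
        calc exp (α * -L) * sin (α * ψ) ≤ exp (α * -L) * (α * ψ) := by gcongr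
          _ ≤ 1 * (α * ψ) := by gcongr
      linarith
    · rw [hBim, mul_comm]
      gcongr
      exact cos_le_cos_of_nonneg_of_le_pi (by linarith) (by linarith) (by linarith)
  have hsq : A ^ 2 - B ^ 2 = x - Complex.exp (α * w) := by
    rw [hA, cpow_inv_two_sq, hB, mul_pow, Complex.I_sq, ← Complex.exp_nat_mul, potC]
    push_cast
    ring_nf
  have hbd : ‖A ^ 2 - B ^ 2‖ ≤ |x| + 1 := by
    rw [hsq]
    refine (norm_sub_le _ _).trans ?_
    rw [Complex.norm_exp]
    have : (α * w : ℂ).re = -(α * L) := by simp [hw]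
    rw [this, Complex.norm_real, Real.norm_eq_abs]
    gcongr
    rw [Real.exp_le_one_iff]; nlinarith
  have hreg : wkbReg α x w - Complex.I =
      Complex.exp (w / 2) * (A - B) + Complex.I * Complex.exp ((α + 1) * w / 2) := by
    rw [wkbReg, wkbC, mul_sub, hB]
    have : Complex.exp (w / 2) * (Complex.I * Complex.exp (-w / 2)) = Complex.I := by
      rw [mul_left_comm, ← Complex.exp_add]; ring_nf; simp
    rw [this]
    ring
  have hn2 : ‖Complex.exp (w / 2)‖ = exp (-(L / 2)) := by
    rw [Complex.norm_exp]; simp [hw, neg_div]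
  have hn3 : ‖Complex.I * Complex.exp ((α + 1) * w / 2)‖ ≤ exp (-L) := by
    rw [norm_mul, Complex.norm_exp, Complex.norm_I, one_mul]
    have : ((α + 1) * w / 2 : ℂ).re = -((α + 1) * L / 2) := by simp [hw, neg_div]
    rw [this, Real.exp_le_exp]
    nlinarith
  rw [hreg]
  refine (norm_add_le _ _).trans ?_
  rw [norm_mul, hn2]
  have h3 : c * exp (L / 2) * ‖A - B‖ ≤ |x| + 1 := by
    rw [← hnB]; exact key.trans hbd
  have h4 : ‖A - B‖ ≤ (|x| + 1) / c * exp (-(L / 2)) := by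
    rw [Real.exp_neg, ← div_eq_mul_inv, div_div, le_div_iff₀ (by positivity)]
    linarith
  have h5 : exp (-(L / 2)) * ‖A - B‖ ≤ (|x| + 1) / c * exp (-L) :=
    calc exp (-(L / 2)) * ‖A - B‖ ≤ exp (-(L / 2)) * ((|x| + 1) / c * exp (-(L / 2))) := by gcongr
      _ = (|x| + 1) / c * (exp (-(L / 2)) * exp (-(L / 2))) := by ring
      _ = _ := by rw [← Real.exp_add]; ring_nf
  linarith

lemma differentiableAt_wkbReg {α x : ℝ} {w : ℂ} (h : potC α x w ∈ Complex.slitPlane) :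
    DifferentiableAt ℂ (wkbReg α x) w := by
  have h1 : DifferentiableAt ℂ (potC α x) w := by
    unfold potC; fun_prop
  have h2 : DifferentiableAt ℂ (fun w => potC α x w ^ (2⁻¹ : ℂ)) w :=
    h1.cpow (differentiableAt_const _) h
  unfold wkbReg wkbC
  fun_prop

lemma norm_rect_le {α x : ℝ} (hα : 1 < α) (hx : rhoC α ≤ x) {L ε δ : ℝ} (hε : 0 < ε)
    (hε' : ε ≤ angleA α)
    (hR : ∀ ψ : ℝ, 0 < ψ → ψ ≤ angleA α → ‖wkbReg α x (L + ψ * Complex.I)‖ ≤ δ)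
    (hLft : ∀ ψ : ℝ, 0 < ψ → ψ ≤ angleA α →
      ‖wkbReg α x (((-L : ℝ) : ℂ) + ψ * Complex.I) - Complex.I‖ ≤ δ) :
    |(∫ W in (-L)..L, (wkbReg α x (W + angleA α * Complex.I)).re) -
      (∫ W in (-L)..L, (wkbReg α x (W + ε * Complex.I)).re) - (angleA α - ε)| ≤
      2 * δ * (angleA α - ε) := by
  have hd : ∀ W ψ : ℝ, 0 < ψ → ψ ≤ angleA α →
      DifferentiableAt ℂ (wkbReg α x) (W + ψ * Complex.I) := fun W ψ h0 h1 =>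
    differentiableAt_wkbReg (potC_mem_slitPlane hα hx W h0 h1)
  have hchor : ∀ ψ : ℝ, 0 < ψ → ψ ≤ angleA α →
      Continuous fun W : ℝ => wkbReg α x (W + ψ * Complex.I) := by
    intro ψ h0 h1
    rw [continuous_iff_continuousAt]
    intro W
    have hc : ContinuousAt (wkbReg α x) (W + ψ * Complex.I) := (hd W ψ h0 h1).continuousAt
    exact ContinuousAt.comp (f := fun W : ℝ => (W + ψ * Complex.I : ℂ)) hc (by fun_prop)
  have hcver : ∀ W : ℝ, IntervalIntegrable (fun ψ : ℝ => wkbReg α x (W + ψ * Complex.I)) volume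
      ε (angleA α) := by
    intro W
    apply ContinuousOn.intervalIntegrable
    intro ψ hψ
    rw [uIcc_of_le hε'] at hψ
    have hc : ContinuousAt (wkbReg α x) (W + ψ * Complex.I) :=
      (hd W ψ (by linarith [hψ.1]) hψ.2).continuousAt
    exact (ContinuousAt.comp (f := fun ψ : ℝ => (W + ψ * Complex.I : ℂ)) hc
      (by fun_prop)).continuousWithinAt
  have hre : ∀ ψ : ℝ, 0 < ψ → ψ ≤ angleA α →
      ∫ W in (-L)..L, (wkbReg α x (W + ψ * Complex.I)).re =
        (∫ W in (-L)..L, wkbReg α x (W + ψ * Complex.I)).re := fun ψ h0 h1 =>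
    Complex.reCLM.intervalIntegral_comp_comm ((hchor ψ h0 h1).intervalIntegrable _ _)
  have hθ := hε.trans_le hε'
  have hrect := Complex.integral_boundary_rect_eq_zero_of_differentiableOn (wkbReg α x)
    ⟨-L, ε⟩ ⟨L, angleA α⟩ (by
      intro z hz
      rw [Complex.mem_reProdIm] at hz
      have h2 := hz.2
      rw [uIcc_of_le hε'] at h2
      have := hd z.re z.im (by linarith [h2.1]) h2.2
      rw [Complex.re_add_im] at this
      exact this.differentiableWithinAt)
  simp only [smul_eq_mul] at hrect
  rw [hre _ hθ le_rfl, hre _ hε hε']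
  set T := ∫ W in (-L)..L, wkbReg α x (W + angleA α * Complex.I)
  set Bt := ∫ W in (-L)..L, wkbReg α x (W + ε * Complex.I)
  set R := ∫ ψ in ε..(angleA α), wkbReg α x (L + ψ * Complex.I)
  have hIR : ‖R‖ ≤ δ * (angleA α - ε) := by
    have := intervalIntegral.norm_integral_le_of_norm_le_const (a := ε) (b := angleA α) (C := δ)
      (f := fun ψ : ℝ => wkbReg α x (L + ψ * Complex.I)) (fun ψ hψ => by
        rw [uIoc_of_le hε'] at hψ
        exact hR ψ (by linarith [hψ.1]) hψ.2)
    rwa [abs_of_nonneg (by linarith)] at this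
  have hIL : ‖(∫ ψ in ε..(angleA α), wkbReg α x (((-L : ℝ) : ℂ) + ψ * Complex.I)) -
      ((angleA α - ε : ℝ) : ℂ) * Complex.I‖ ≤ δ * (angleA α - ε) := by
    have e : ((angleA α - ε : ℝ) : ℂ) * Complex.I = ∫ ψ in ε..(angleA α), Complex.I := by
      simp
    rw [e, ← intervalIntegral.integral_sub (hcver _) (by simp)]
    have := intervalIntegral.norm_integral_le_of_norm_le_const (a := ε) (b := angleA α) (C := δ)
      (f := fun ψ : ℝ => wkbReg α x (((-L : ℝ) : ℂ) + ψ * Complex.I) - Complex.I) (fun ψ hψ => by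
        rw [uIoc_of_le hε'] at hψ
        exact hLft ψ (by linarith [hψ.1]) hψ.2)
    rwa [abs_of_nonneg (by linarith)] at this
  set Lf := ∫ ψ in ε..(angleA α), wkbReg α x (((-L : ℝ) : ℂ) + ψ * Complex.I)
  have heq : T - Bt - ((angleA α - ε : ℝ) : ℂ) =
      Complex.I * R - Complex.I * (Lf - ((angleA α - ε : ℝ) : ℂ) * Complex.I) := by
    have h2 : Bt - T + Complex.I * R - Complex.I * Lf = 0 := hrect
    linear_combination (-1 : ℂ) * h2 - ((angleA α - ε : ℝ) : ℂ) * Complex.I_mul_I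
  have hre2 : T.re - Bt.re - (angleA α - ε) = (T - Bt - ((angleA α - ε : ℝ) : ℂ)).re := by
    simp
  rw [hre2]
  refine (Complex.abs_re_le_norm _).trans ?_
  rw [heq]
  refine (norm_sub_le _ _).trans ?_
  rw [norm_mul, norm_mul, Complex.norm_I]
  linarith

/-- The WKB integrand on the real line. -/
def wkbR (α x W : ℝ) : ℝ := exp (W / 2) * √(x - exp (α * W) - exp (-W))

/-- The real part of the WKB integrand on the line of imaginary part `2π/(1+α)`. -/
def wkbTop (α x W : ℝ) : ℝ :=
  exp (W / 2) * √((√((exp (α * W) + exp (-W) - x * cos (angleA α)) ^ 2 +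
    (x * sin (angleA α)) ^ 2) - (exp (α * W) + exp (-W) - x * cos (angleA α))) / 2)

lemma norm_cpow_inv_two_potC_le (α x W ψ : ℝ) :
    ‖potC α x (W + ψ * Complex.I) ^ (2⁻¹ : ℂ)‖ ≤ |x| + exp (α * W) + exp (-W) + 1 := by
  have h1 : ‖potC α x (W + ψ * Complex.I)‖ ≤ |x| + exp (α * W) + exp (-W) := by
    unfold potC
    refine (norm_sub_le _ _).trans ?_
    refine (add_le_add_left (norm_sub_le _ _) _).trans ?_
    rw [Complex.norm_exp, Complex.norm_exp]
    simp
  have h2 := congrArg norm (cpow_inv_two_sq (potC α x (W + ψ * Complex.I)))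
  rw [norm_pow] at h2
  nlinarith [norm_nonneg (potC α x (W + ψ * Complex.I) ^ (2⁻¹ : ℂ))]

lemma norm_wkbReg_le (α x W ψ : ℝ) : ‖wkbReg α x (W + ψ * Complex.I)‖ ≤
    exp (W / 2) * (|x| + exp (α * W) + exp (-W) + 1) + exp ((α + 1) * W / 2) := by
  unfold wkbReg wkbC
  refine (norm_add_le _ _).trans ?_
  rw [norm_mul, norm_mul, Complex.norm_I, one_mul, Complex.norm_exp, Complex.norm_exp]
  have e1 : ((W + ψ * Complex.I : ℂ) / 2).re = W / 2 := by simp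
  have e2 : ((α + 1) * (W + ψ * Complex.I : ℂ) / 2).re = (α + 1) * W / 2 := by simp
  rw [e1, e2]
  gcongr
  exact norm_cpow_inv_two_potC_le α x W ψ

lemma wkbReg_re (α x W ψ : ℝ) : (wkbReg α x (W + ψ * Complex.I)).re =
    exp (W / 2) * (cos (ψ / 2) * (potC α x (W + ψ * Complex.I) ^ (2⁻¹ : ℂ)).re -
      sin (ψ / 2) * (potC α x (W + ψ * Complex.I) ^ (2⁻¹ : ℂ)).im) -
      exp ((α + 1) * W / 2) * sin ((α + 1) * ψ / 2) := by
  unfold wkbReg wkbC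
  have e1 : ((W + ψ * Complex.I : ℂ) / 2).re = W / 2 := by simp
  have e2 : ((α + 1) * (W + ψ * Complex.I : ℂ) / 2).re = (α + 1) * W / 2 := by simp
  have e3 : ((W + ψ * Complex.I : ℂ) / 2).im = ψ / 2 := by simp
  have e4 : ((α + 1) * (W + ψ * Complex.I : ℂ) / 2).im = (α + 1) * ψ / 2 := by simp
  simp only [Complex.add_re, Complex.mul_re, Complex.I_re, Complex.I_im, Complex.exp_re,
    Complex.exp_im, e1, e2, e3, e4]
  ring

lemma tendsto_wkbReg_re (α x W : ℝ) :
    Tendsto (fun ε : ℝ => (wkbReg α x (W + ε * Complex.I)).re) (𝓝[>] 0) (𝓝 (wkbR α x W)) := by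
  refine Tendsto.mono_left ?_ nhdsWithin_le_nhds
  simp only [wkbReg_re]
  have hV : Continuous fun ε : ℝ => potC α x (W + ε * Complex.I) := by
    unfold potC; fun_prop
  have h1 : Tendsto (fun ε : ℝ => (potC α x (W + ε * Complex.I) ^ (2⁻¹ : ℂ)).re) (𝓝 0)
      (𝓝 (√(x - exp (α * W) - exp (-W)))) := by
    simp only [Complex.cpow_inv_two_re]
    have hc : Continuous fun ε : ℝ => √((‖potC α x (W + ε * Complex.I)‖ +
        (potC α x (W + ε * Complex.I)).re) / 2) := by fun_prop
    have h := hc.tendsto 0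
    have h0 : potC α x (W + (0 : ℝ) * Complex.I) = ((x - exp (α * W) - exp (-W) : ℝ) : ℂ) := by
      simp [potC]
    rw [h0, Complex.norm_real, Complex.ofReal_re, Real.norm_eq_abs] at h
    convert h using 2
    rcases le_total 0 (x - exp (α * W) - exp (-W)) with h2 | h2
    · rw [abs_of_nonneg h2]; congr 1; ring
    · rw [abs_of_nonpos h2, Real.sqrt_eq_zero_of_nonpos h2]; simp
  have h2 : Tendsto (fun ε : ℝ => sin (ε / 2) *
      (potC α x (W + ε * Complex.I) ^ (2⁻¹ : ℂ)).im) (𝓝 0) (𝓝 0) := by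
    refine squeeze_zero_norm (a := fun ε => |sin (ε / 2)| *
      (|x| + exp (α * W) + exp (-W) + 1)) (fun ε => ?_) ?_
    · rw [norm_mul, Real.norm_eq_abs, Real.norm_eq_abs]
      gcongr
      exact (Complex.abs_im_le_norm _).trans (norm_cpow_inv_two_potC_le α x W ε)
    · have hc : Continuous fun ε : ℝ => |sin (ε / 2)| *
        (|x| + exp (α * W) + exp (-W) + 1) := by fun_prop
      simpa using hc.tendsto 0
  have h3 : Tendsto (fun ε : ℝ => cos (ε / 2)) (𝓝 0) (𝓝 1) := by
    have hc : Continuous fun ε : ℝ => cos (ε / 2) := by fun_prop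
    simpa using hc.tendsto 0
  have h4 : Tendsto (fun ε : ℝ => exp ((α + 1) * W / 2) * sin ((α + 1) * ε / 2)) (𝓝 0) (𝓝 0) := by
    have hc : Continuous fun ε : ℝ => exp ((α + 1) * W / 2) * sin ((α + 1) * ε / 2) := by fun_prop
    simpa using hc.tendsto 0
  have := (((h3.mul h1).sub h2).const_mul (exp (W / 2))).sub h4
  simpa [wkbR] using this

lemma wkbReg_angleA_re {α : ℝ} (hα : 1 < α) (x W : ℝ) (hx : 0 < x) :
    (wkbReg α x (W + angleA α * Complex.I)).re = wkbTop α x W := by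
  have hθ0 := angleA_pos hα
  have hθ := angleA_lt_pi hα
  rw [wkbReg_re, wkbTop]
  have e0 : sin ((α + 1) * angleA α / 2) = 0 := by
    rw [add_one_mul_angleA hα, mul_div_cancel_left₀ _ (by norm_num : (2 : ℝ) ≠ 0), sin_pi]
  rw [e0, mul_zero, sub_zero]
  congr 1
  set B := potC α x (W + angleA α * Complex.I) ^ (2⁻¹ : ℂ) with hB
  have hBre : 0 ≤ B.re := cpow_inv_two_re_nonneg _
  have hsq : B ^ 2 = potC α x (W + angleA α * Complex.I) := cpow_inv_two_sq _
  have ec : cos (α * angleA α) = cos (angleA α) := by rw [mul_angleA hα, cos_two_pi_sub]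
  have es : sin (α * angleA α) = -sin (angleA α) := by rw [mul_angleA hα, sin_two_pi_sub]
  have h1 := congrArg Complex.re hsq
  have h2 := congrArg Complex.im hsq
  rw [potC_re, ec, sq, Complex.mul_re] at h1
  rw [potC_im, es, sq, Complex.mul_im] at h2
  set m := exp (α * W) + exp (-W) with hm
  set c := cos (angleA α / 2) with hc
  set s := sin (angleA α / 2) with hs
  have hcpos : 0 < c := cos_pos_of_mem_Ioo ⟨by linarith, by linarith⟩
  have hspos : 0 < s := sin_pos_of_pos_of_lt_pi (by linarith) (by linarith)
  have hcs : s ^ 2 + c ^ 2 = 1 := sin_sq_add_cos_sq _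
  have hcos : cos (angleA α) = c ^ 2 - s ^ 2 := by
    rw [show angleA α = 2 * (angleA α / 2) by ring, cos_two_mul']
  have hsin : sin (angleA α) = 2 * s * c := by
    rw [show angleA α = 2 * (angleA α / 2) by ring, sin_two_mul]
  rw [hcos] at h1 ⊢
  rw [hsin] at h2 ⊢
  set u := c * B.re - s * B.im with hu
  set v := c * B.im + s * B.re with hv
  have hBu : B.re = c * u + s * v := by
    rw [hu, hv]; linear_combination (-B.re) * hcs
  have hBv : B.im = c * v - s * u := by
    rw [hu, hv]; linear_combination (-B.im) * hcs
  have hre : u ^ 2 - v ^ 2 = x * (c ^ 2 - s ^ 2) - m := by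
    have : u ^ 2 - v ^ 2 = (c ^ 2 - s ^ 2) * (B.re * B.re - B.im * B.im) -
        2 * s * c * (B.re * B.im + B.im * B.re) := by rw [hu, hv]; ring
    rw [this, h1, h2]
    linear_combination (-m) * (s ^ 2 + c ^ 2 + 1) * hcs
  have him : 2 * u * v = x * (2 * s * c) := by
    have : 2 * u * v = (c ^ 2 - s ^ 2) * (B.re * B.im + B.im * B.re) +
        2 * s * c * (B.re * B.re - B.im * B.im) := by rw [hu, hv]; ring
    rw [this, h1, h2]
    ring
  have hu0 : 0 ≤ u := by
    by_contra! hneg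
    have hv0 : v < 0 := by
      by_contra! hv0
      have : 0 < x * (2 * s * c) := by positivity
      nlinarith
    have : B.re < 0 := by rw [hBu]; nlinarith
    linarith
  have hr : √((m - x * (c ^ 2 - s ^ 2)) ^ 2 + (x * (2 * s * c)) ^ 2) = u ^ 2 + v ^ 2 := by
    rw [← him, show m - x * (c ^ 2 - s ^ 2) = v ^ 2 - u ^ 2 by linarith,
      show (v ^ 2 - u ^ 2) ^ 2 + (2 * u * v) ^ 2 = (u ^ 2 + v ^ 2) ^ 2 by ring]
    exact Real.sqrt_sq (by positivity)
  rw [hr, show (u ^ 2 + v ^ 2 - (m - x * (c ^ 2 - s ^ 2))) / 2 = u ^ 2 by linarith,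
    Real.sqrt_sq hu0]

lemma continuous_wkbR (α x : ℝ) : Continuous (wkbR α x) := by
  unfold wkbR; fun_prop

lemma continuous_wkbTop (α x : ℝ) : Continuous (wkbTop α x) := by
  unfold wkbTop; fun_prop

lemma wkbR_nonneg (α x W : ℝ) : 0 ≤ wkbR α x W := by
  unfold wkbR; positivity

lemma wkbTop_nonneg (α x W : ℝ) : 0 ≤ wkbTop α x W := by
  unfold wkbTop; positivity

lemma integrable_wkbR {α : ℝ} (hα : 1 < α) (x : ℝ) : Integrable (wkbR α x) := by
  refine (continuous_wkbR α x).integrable_of_hasCompactSupport ?_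
  refine HasCompactSupport.intro (isCompact_Icc (a := -(|x| + 1)) (b := |x| + 1)) fun W hW => ?_
  have hx := le_abs_self x
  have hx0 := abs_nonneg x
  have e1 := Real.add_one_le_exp (α * W)
  have e2 := Real.add_one_le_exp (-W)
  have p1 := exp_pos (α * W)
  have p2 := exp_pos (-W)
  rw [wkbR, Real.sqrt_eq_zero_of_nonpos, mul_zero]
  rw [mem_Icc, not_and_or, not_le, not_le] at hW
  rcases hW with h | h
  · linarith
  · nlinarith

lemma tendsto_integral_wkbReg_re {α x : ℝ} (hα : 1 < α) (hx : rhoC α ≤ x) (L : ℝ) :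
    Tendsto (fun ε : ℝ => ∫ W in (-L)..L, (wkbReg α x (W + ε * Complex.I)).re) (𝓝[>] 0)
      (𝓝 (∫ W in (-L)..L, wkbR α x W)) := by
  have hev : ∀ᶠ ε : ℝ in 𝓝[>] 0, 0 < ε ∧ ε < angleA α :=
    Ioo_mem_nhdsGT (angleA_pos hα)
  refine intervalIntegral.tendsto_integral_filter_of_dominated_convergence
    (fun W => exp (W / 2) * (|x| + exp (α * W) + exp (-W) + 1) + exp ((α + 1) * W / 2)) ?_ ?_ ?_ ?_
  · filter_upwards [hev] with ε hε
    refine Continuous.aestronglyMeasurable ?_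
    rw [continuous_iff_continuousAt]
    intro W
    have hc : ContinuousAt (wkbReg α x) (W + ε * Complex.I) :=
      (differentiableAt_wkbReg (potC_mem_slitPlane hα hx W hε.1 hε.2.le)).continuousAt
    exact Complex.continuous_re.continuousAt.comp
      (ContinuousAt.comp (f := fun W : ℝ => (W + ε * Complex.I : ℂ)) hc (by fun_prop))
  · refine Eventually.of_forall fun ε => Eventually.of_forall fun W _ => ?_
    exact (Complex.abs_re_le_norm _).trans (norm_wkbReg_le α x W ε)
  · exact Continuous.intervalIntegrable (by fun_prop) _ _
  · exact Eventually.of_forall fun W _ => tendsto_wkbReg_re α x W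

lemma abs_integral_wkbTop_sub_le {α x : ℝ} (hα : 1 < α) (hx : rhoC α ≤ x) {L δ : ℝ}
    (hR : ∀ ψ : ℝ, 0 < ψ → ψ ≤ angleA α → ‖wkbReg α x (L + ψ * Complex.I)‖ ≤ δ)
    (hLft : ∀ ψ : ℝ, 0 < ψ → ψ ≤ angleA α →
      ‖wkbReg α x (((-L : ℝ) : ℂ) + ψ * Complex.I) - Complex.I‖ ≤ δ) :
    |(∫ W in (-L)..L, wkbTop α x W) - ((∫ W in (-L)..L, wkbR α x W) + angleA α)| ≤
      2 * δ * angleA α := by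
  have hev : ∀ᶠ ε : ℝ in 𝓝[>] 0, 0 < ε ∧ ε < angleA α :=
    Ioo_mem_nhdsGT (angleA_pos hα)
  have hid : Tendsto (fun ε : ℝ => angleA α - ε) (𝓝[>] 0) (𝓝 (angleA α)) := by
    refine Tendsto.mono_left ?_ nhdsWithin_le_nhds
    simpa using (tendsto_const_nhds (x := angleA α)).sub (tendsto_id (α := ℝ) (x := 𝓝 0))
  have h1 := (((tendsto_const_nhds (x := ∫ W in (-L)..L, wkbTop α x W)).sub
    (tendsto_integral_wkbReg_re hα hx L)).sub hid).abs
  have h2 := hid.const_mul (2 * δ)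
  have h3 := le_of_tendsto_of_tendsto h1 h2 (by
    filter_upwards [hev] with ε hε
    have := norm_rect_le hα hx hε.1 hε.2.le hR hLft
    simpa only [wkbReg_angleA_re hα x _ ((rhoC_pos hα).trans_le hx)] using this)
  rwa [sub_sub] at h3

lemma tendsto_integral_wkbTop {α x : ℝ} (hα : 1 < α) (hx : rhoC α ≤ x) :
    Tendsto (fun L : ℝ => ∫ W in (-L)..L, wkbTop α x W) atTop
      (𝓝 ((∫ W, wkbR α x W) + angleA α)) := by
  obtain ⟨C, hC⟩ := norm_wkbReg_right_le hα x
  obtain ⟨C', L₀, hC'⟩ := norm_wkbReg_left_le hα x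
  have hlim := (intervalIntegral_tendsto_integral (integrable_wkbR hα x)
    tendsto_neg_atTop_atBot tendsto_id).add_const (angleA α)
  have hdecay : ∀ {k : ℝ}, 0 < k → ∀ C : ℝ,
      Tendsto (fun L : ℝ => |C * exp (-(k * L))|) atTop (𝓝 0) := by
    intro k hk C
    have h := (Real.tendsto_exp_neg_atTop_nhds_zero.comp
      (tendsto_id.const_mul_atTop hk)).const_mul C
    simpa using h.abs
  have hdiff : Tendsto (fun L : ℝ => (∫ W in (-L)..L, wkbTop α x W) -
      ((∫ W in (-L)..L, wkbR α x W) + angleA α)) atTop (𝓝 0) := by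
    refine squeeze_zero_norm' (a := fun L : ℝ => 2 * (|C * exp (-((α - 1) / 2 * L))| +
      |C' * exp (-(1 * L))|) * angleA α) ?_ ?_
    · filter_upwards [eventually_ge_atTop 0, eventually_ge_atTop L₀] with L hL hL'
      rw [Real.norm_eq_abs]
      refine abs_integral_wkbTop_sub_le hα hx (fun ψ h0 h1 => ?_) (fun ψ h0 h1 => ?_)
      · exact (hC L ψ hL h0 h1).trans ((le_abs_self _).trans
          (le_add_of_nonneg_right (abs_nonneg _)))
      · have := hC' L ψ hL' h0 h1
        rw [one_mul]
        exact this.trans ((le_abs_self _).trans (le_add_of_nonneg_left (abs_nonneg _)))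
    · have := (((hdecay (k := (α - 1) / 2) (by linarith) C).add
        (hdecay one_pos C')).const_mul 2).mul_const (angleA α)
      simpa using this
  simpa using hdiff.add hlim

lemma integrable_wkbTop {α x : ℝ} (hα : 1 < α) (hx : rhoC α ≤ x) : Integrable (wkbTop α x) := by
  refine integrable_of_intervalIntegral_norm_tendsto (l := atTop) (a := fun L : ℝ => -L) (b := id)
    ((∫ W, wkbR α x W) + angleA α) (fun L => ?_) tendsto_neg_atTop_atBot tendsto_id ?_
  · exact (continuous_wkbTop α x).integrableOn_Ioc
  · simp only [Real.norm_of_nonneg (wkbTop_nonneg α x _)]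
    exact tendsto_integral_wkbTop hα hx

/-- Rotating the contour by the angle `2π/(1+α)` changes the WKB integral by that angle. -/
lemma integral_wkbTop {α x : ℝ} (hα : 1 < α) (hx : rhoC α ≤ x) :
    ∫ W, wkbTop α x W = (∫ W, wkbR α x W) + angleA α :=
  tendsto_nhds_unique (intervalIntegral_tendsto_integral (integrable_wkbTop hα hx)
    tendsto_neg_atTop_atBot tendsto_id) (tendsto_integral_wkbTop hα hx)

lemma continuous_Vfun {α : ℝ} (hα : 1 < α) (x : ℝ) : Continuous (Vfun α x) := by
  unfold Vfun
  have : Continuous fun u : ℝ => u ^ (2 * α + 2) :=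
    Real.continuous_rpow_const (by linarith)
  fun_prop

lemma Vfun_zero {α : ℝ} (hα : 1 < α) (x : ℝ) : Vfun α x 0 = -1 := by
  simp [Vfun, Real.zero_rpow (by linarith : 2 * α + 2 ≠ 0)]

lemma Vfun_neg_of_large {α : ℝ} (hα : 1 < α) {x u : ℝ} (hu : |x| + 1 ≤ u) : Vfun α x u < 0 := by
  have hx := le_abs_self x
  have hx0 := abs_nonneg x
  have h1 : u ^ (4 : ℝ) ≤ u ^ (2 * α + 2) :=
    Real.rpow_le_rpow_of_exponent_le (by linarith) (by linarith)
  have h2 : u ^ (4 : ℝ) = u ^ 2 * u ^ 2 := by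
    rw [show (4 : ℝ) = (4 : ℕ) by norm_num, Real.rpow_natCast]; ring
  have h3 : x * u ^ 2 ≤ u ^ 2 * u ^ 2 := by
    apply mul_le_mul_of_nonneg_right _ (sq_nonneg u)
    nlinarith
  rw [h2] at h1
  unfold Vfun
  linarith

lemma Vfun_exp_half (α x W : ℝ) :
    Vfun α x (exp (W / 2)) = exp W * (x - exp (α * W) - exp (-W)) := by
  unfold Vfun
  rw [← Real.exp_mul, ← Real.exp_nat_mul, mul_sub, mul_sub, ← Real.exp_add, ← Real.exp_add]
  push_cast
  ring_nf
  simp only [Real.exp_zero]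
  ring

lemma u1F_nonneg (α x : ℝ) : 0 ≤ u1F α x :=
  Real.sInf_nonneg fun _ hu => hu.1.le

lemma bddAbove_roots {α : ℝ} (hα : 1 < α) (x : ℝ) :
    BddAbove {u : ℝ | 0 < u ∧ Vfun α x u = 0} := by
  refine ⟨|x| + 1, fun u hu => ?_⟩
  by_contra! h
  exact (Vfun_neg_of_large hα h.le).ne hu.2

lemma bddBelow_roots (α x : ℝ) : BddBelow {u : ℝ | 0 < u ∧ Vfun α x u = 0} :=
  ⟨0, fun _ hu => hu.1.le⟩

lemma mem_Ioc_of_Vfun_pos {α : ℝ} (hα : 1 < α) {x u : ℝ} (hu : 0 < u) (hV : 0 < Vfun α x u) :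
    u ∈ Ioc (u1F α x) (u2F α x) := by
  constructor
  · obtain ⟨r, hr, hr0⟩ := intermediate_value_Icc hu.le (continuous_Vfun hα x).continuousOn
      (show (0 : ℝ) ∈ Icc _ _ from ⟨by rw [Vfun_zero hα]; norm_num, hV.le⟩)
    have hrpos : 0 < r := by
      refine hr.1.lt_of_ne fun h => ?_
      rw [← h, Vfun_zero hα] at hr0
      norm_num at hr0
    have hru : r < u := by
      refine hr.2.lt_of_ne fun h => ?_
      rw [h] at hr0
      exact hV.ne' hr0
    exact (csInf_le (bddBelow_roots α x) ⟨hrpos, hr0⟩).trans_lt hru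
  · have hle : u ≤ |x| + 1 := by
      by_contra! h
      exact absurd hV (Vfun_neg_of_large hα h.le).not_gt
    obtain ⟨r, hr, hr0⟩ := intermediate_value_Icc' hle (continuous_Vfun hα x).continuousOn
      (show (0 : ℝ) ∈ Icc _ _ from ⟨(Vfun_neg_of_large hα le_rfl).le, hV.le⟩)
    exact hr.1.trans (le_csSup (bddAbove_roots hα x) ⟨hu.trans_le hr.1, hr0⟩)

lemma integral_sqrt_Vfun_roots {α : ℝ} (hα : 1 < α) (x : ℝ) :
    ∫ u in u1F α x..u2F α x, √(Vfun α x u) / u = ∫ u in Ioi 0, √(Vfun α x u) / u := by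
  have hle : u1F α x ≤ u2F α x :=
    Real.sInf_le_sSup _ (bddBelow_roots α x) (bddAbove_roots hα x)
  rw [intervalIntegral.integral_of_le hle]
  refine (setIntegral_eq_of_subset_of_forall_sdiff_eq_zero measurableSet_Ioi
    (fun u hu => (u1F_nonneg α x).trans_lt hu.1) fun u hu => ?_).symm
  have : Vfun α x u ≤ 0 := by
    by_contra! h
    exact hu.2 (mem_Ioc_of_Vfun_pos hα hu.1 h)
  rw [Real.sqrt_eq_zero_of_nonpos this, zero_div]

lemma integral_sqrt_Vfun (α x : ℝ) :
    ∫ u in Ioi 0, √(Vfun α x u) / u = (∫ W, wkbR α x W) / 2 := by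
  have himg : (fun W : ℝ => exp (W / 2)) '' univ = Ioi 0 := by
    rw [image_univ]
    ext u
    refine ⟨fun ⟨W, hW⟩ => hW ▸ exp_pos _, fun hu => ⟨2 * Real.log u, ?_⟩⟩
    simp only
    rw [mul_div_cancel_left₀ _ two_ne_zero, Real.exp_log hu]
  rw [← himg, integral_image_eq_integral_abs_deriv_smul (f' := fun W => exp (W / 2) * (1 / 2))
    MeasurableSet.univ]
  · rw [setIntegral_univ, ← integral_div]
    refine integral_congr_ae (Eventually.of_forall fun W => ?_)
    simp only [smul_eq_mul]
    have h2 : exp W = exp (W / 2) ^ 2 := by rw [← Real.exp_nat_mul]; ring_nf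
    rw [Vfun_exp_half, abs_of_pos (by positivity), Real.sqrt_mul (exp_pos _).le, h2,
      Real.sqrt_sq (exp_pos _).le, wkbR]
    field_simp
  · intro W _
    exact (((hasDerivAt_id W).div_const 2).exp).hasDerivWithinAt
  · intro a _ b _ hab
    have := Real.exp_injective hab
    linarith

lemma wkbR_eq_zero {α x : ℝ} (hα : 1 < α) (hx : x ≤ rhoC α) (W : ℝ) : wkbR α x W = 0 := by
  rw [wkbR, Real.sqrt_eq_zero_of_nonpos (by linarith [rhoC_le_exp_add_exp hα W]), mul_zero]

lemma tauF_eq {α : ℝ} (hα : 1 < α) (ξ : ℝ) :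
    tauF α ξ = (1 + α) / π * ∫ W, wkbR α (rhoC α * ξ) W := by
  unfold tauF Sfun
  split_ifs with h
  · rw [integral_sqrt_Vfun_roots hα, integral_sqrt_Vfun]
    field_simp
  · simp [wkbR_eq_zero hα (not_lt.1 h)]

lemma tauF_nonneg {α : ℝ} (hα : 1 < α) (ξ : ℝ) : 0 ≤ tauF α ξ := by
  rw [tauF_eq hα]
  have : 0 ≤ ∫ W, wkbR α (rhoC α * ξ) W := integral_nonneg fun W => wkbR_nonneg α _ W
  have := pi_pos
  positivity

lemma tauF_eq_zero {α : ℝ} (hα : 1 < α) {ξ : ℝ} (hξ : ξ ≤ 1) : tauF α ξ = 0 := by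
  have : rhoC α * ξ ≤ rhoC α := mul_le_of_le_one_right (rhoC_pos hα).le hξ
  rw [tauF_eq hα]
  simp [wkbR_eq_zero hα this]

/-- The antiderivative of `2v²/((v²+p)²+q²)`, in terms of `b = √(2(r-p))`, `h = √((r+p)/2)` and
`r = √(p²+q²)`. -/
lemma hasDerivAt_rational_antideriv {b h r : ℝ} (hb : 0 < b) (hh : 0 < h)
    (hr : r = h ^ 2 + b ^ 2 / 4) (v : ℝ) :
    HasDerivAt (fun v => (Real.log (v ^ 2 - b * v + r) - Real.log (v ^ 2 + b * v + r)) / (2 * b) +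
      (Real.arctan ((v - b / 2) / h) + Real.arctan ((v + b / 2) / h)) / (2 * h))
      (2 * v ^ 2 / ((v ^ 2 + r) ^ 2 - b ^ 2 * v ^ 2)) v := by
  have h1 : 0 < v ^ 2 - b * v + r := by rw [hr]; nlinarith [sq_nonneg (v - b / 2), sq_pos_of_pos hh]
  have h2 : 0 < v ^ 2 + b * v + r := by rw [hr]; nlinarith [sq_nonneg (v + b / 2), sq_pos_of_pos hh]
  have d1 : HasDerivAt (fun v => v ^ 2 - b * v + r) (2 * v - b) v := by
    simpa using (((hasDerivAt_pow 2 v).sub ((hasDerivAt_id v).const_mul b)).add_const r)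
  have d2 : HasDerivAt (fun v => v ^ 2 + b * v + r) (2 * v + b) v := by
    simpa using (((hasDerivAt_pow 2 v).add ((hasDerivAt_id v).const_mul b)).add_const r)
  have d3 : HasDerivAt (fun v => (v - b / 2) / h) (1 / h) v :=
    ((hasDerivAt_id v).sub_const (b / 2)).div_const h
  have d4 : HasDerivAt (fun v => (v + b / 2) / h) (1 / h) v :=
    ((hasDerivAt_id v).add_const (b / 2)).div_const h
  refine ((((d1.log h1.ne').sub (d2.log h2.ne')).div_const (2 * b)).add
    ((d3.arctan.add d4.arctan).div_const (2 * h))).congr_deriv ?_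
  have e1 : (v ^ 2 + r) ^ 2 - b ^ 2 * v ^ 2 = (v ^ 2 - b * v + r) * (v ^ 2 + b * v + r) := by ring
  have e2 : 1 + ((v - b / 2) / h) ^ 2 = (v ^ 2 - b * v + r) / h ^ 2 := by
    rw [hr]; field_simp; ring
  have e3 : 1 + ((v + b / 2) / h) ^ 2 = (v ^ 2 + b * v + r) / h ^ 2 := by
    rw [hr]; field_simp; ring
  rw [e1, e2, e3, one_div_div, one_div_div]
  obtain ⟨P, hP⟩ : ∃ P, P = v ^ 2 - b * v + r := ⟨_, rfl⟩
  obtain ⟨Q, hQ⟩ : ∃ Q, Q = v ^ 2 + b * v + r := ⟨_, rfl⟩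
  rw [← hP] at h1 ⊢
  rw [← hQ] at h2 ⊢
  field_simp
  rw [hP, hQ]
  ring

lemma tendsto_rational_antideriv {b h r : ℝ} (hb : 0 < b) (hh : 0 < h) (hr : 0 < r) :
    Tendsto (fun v => (Real.log (v ^ 2 - b * v + r) - Real.log (v ^ 2 + b * v + r)) / (2 * b) +
      (Real.arctan ((v - b / 2) / h) + Real.arctan ((v + b / 2) / h)) / (2 * h)) atTop
      (𝓝 (π / (2 * h))) := by
  have harc : ∀ k : ℝ, Tendsto (fun v : ℝ => Real.arctan ((v + k) / h)) atTop (𝓝 (π / 2)) :=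
    fun k => (tendsto_nhds_of_tendsto_nhdsWithin Real.tendsto_arctan_atTop).comp
      ((tendsto_atTop_add_const_right _ k tendsto_id).atTop_div_const hh)
  have hratio : Tendsto (fun v : ℝ => 1 - 2 * b * v / (v ^ 2 + b * v + r)) atTop (𝓝 1) := by
    have h0 : Tendsto (fun v : ℝ => 2 * b * v / (v ^ 2 + b * v + r)) atTop (𝓝 0) := by
      refine squeeze_zero' (g := fun v => 2 * b / v) ?_ ?_
        (tendsto_const_nhds.div_atTop tendsto_id)
      · filter_upwards [eventually_gt_atTop 0] with v hv
        positivity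
      · filter_upwards [eventually_gt_atTop 0] with v hv
        rw [div_le_div_iff₀ (by positivity) hv]
        have : 0 < b * (b * v + r) := by positivity
        nlinarith
    simpa using h0.const_sub 1
  have hlog : Tendsto (fun v : ℝ => Real.log (v ^ 2 - b * v + r) - Real.log (v ^ 2 + b * v + r))
      atTop (𝓝 0) := by
    have := (Real.continuousAt_log one_ne_zero).tendsto.comp hratio
    rw [Real.log_one] at this
    refine this.congr' ?_
    filter_upwards [eventually_gt_atTop b] with v hv
    have hv0 : 0 < v := hb.trans hv
    have h2 : 0 < v ^ 2 + b * v + r := by positivity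
    have h1 : 0 < v ^ 2 - b * v + r := by nlinarith
    rw [← Real.log_div h1.ne' h2.ne', Function.comp_apply]
    congr 1
    field_simp
    ring
  have := (hlog.div_const (2 * b)).add
    (((harc (-(b / 2))).add (harc (b / 2))).div_const (2 * h))
  simpa [sub_eq_add_neg] using this

lemma exists_rational_antideriv {q : ℝ} (p : ℝ) (hq : 0 < q) :
    ∃ A : ℝ → ℝ, (∀ v, HasDerivAt A (2 * v ^ 2 / ((v ^ 2 + p) ^ 2 + q ^ 2)) v) ∧ A 0 = 0 ∧
      Tendsto A atTop (𝓝 (π / q * √((√(p ^ 2 + q ^ 2) - p) / 2))) := by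
  set r := √(p ^ 2 + q ^ 2) with hr
  have hrsq : r ^ 2 = p ^ 2 + q ^ 2 := Real.sq_sqrt (by positivity)
  have hrp : |p| < r := by
    rw [hr, ← Real.sqrt_sq_eq_abs]
    exact Real.sqrt_lt_sqrt (sq_nonneg p) (by nlinarith)
  have h1 := (abs_lt.1 hrp).1
  have h2 := (abs_lt.1 hrp).2
  have hrpos : 0 < r := (abs_nonneg p).trans_lt hrp
  set k := √((r - p) / 2) with hk
  have hkpos : 0 < k := Real.sqrt_pos.2 (by linarith)
  have hksq : k ^ 2 = (r - p) / 2 := Real.sq_sqrt (by linarith)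
  set h := √((r + p) / 2) with hh
  have hhpos : 0 < h := Real.sqrt_pos.2 (by linarith)
  have hhsq : h ^ 2 = (r + p) / 2 := Real.sq_sqrt (by linarith)
  have hkh : 2 * k * h = q := by
    rw [← abs_of_pos hq, ← abs_of_pos (show 0 < 2 * k * h by positivity), ← sq_eq_sq_iff_abs_eq_abs,
      mul_pow, mul_pow, hksq, hhsq]
    linarith
  refine ⟨_, fun v => (hasDerivAt_rational_antideriv (b := 2 * k) (h := h) (r := r) (by positivity)
    hhpos (by rw [mul_pow, hksq, hhsq]; ring) v).congr_deriv ?_, ?_, ?_⟩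
  · congr 1
    rw [mul_pow, hksq]
    linear_combination hrsq
  · simp [neg_div, Real.arctan_neg]
  · have := tendsto_rational_antideriv (b := 2 * k) (by positivity) hhpos hrpos
    convert this using 2
    rw [← hkh]
    field_simp

lemma Ka_div {α ξ y : ℝ} (hy : y ≠ 0) : Ka α (ξ / y) / y =
    sin (angleA α) / π * (ξ / (y ^ 2 + ξ ^ 2 - 2 * ξ * y * cos (angleA α))) := by
  unfold Ka
  rw [← angleA, mul_div_assoc]
  congr 1
  have : 1 + (ξ / y) ^ 2 - 2 * (ξ / y) * cos (angleA α) =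
      (y ^ 2 + ξ ^ 2 - 2 * ξ * y * cos (angleA α)) / y ^ 2 := by
    field_simp
  rw [this]
  rcases eq_or_ne (y ^ 2 + ξ ^ 2 - 2 * ξ * y * cos (angleA α)) 0 with h | h
  · simp [h]
  · field_simp

lemma integral_Ka_mul_wkbR {α ξ : ℝ} (hα : 1 < α) (hξ : 0 < ξ) (W : ℝ) :
    IntegrableOn (fun y => Ka α (ξ / y) / y * wkbR α (rhoC α * y) W) (Ici 1) ∧
      ∫ y in Ici 1, Ka α (ξ / y) / y * wkbR α (rhoC α * y) W = wkbTop α (rhoC α * ξ) W := by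
  have hρ := rhoC_pos hα
  have hs : 0 < sin (angleA α) := sin_pos_of_pos_of_lt_pi (angleA_pos hα) (angleA_lt_pi hα)
  set m := exp (α * W) + exp (-W) with hm
  have hmρ : rhoC α ≤ m := rhoC_le_exp_add_exp hα W
  set q := rhoC α * ξ * sin (angleA α) with hq
  have hqpos : 0 < q := by positivity
  set p := m - rhoC α * ξ * cos (angleA α) with hp
  obtain ⟨A, hA, hA0, hAlim⟩ := exists_rational_antideriv p hqpos
  set a := m / rhoC α with ha
  have ha1 : 1 ≤ a := (one_le_div hρ).2 hmρ
  have hzero : ∀ y ∈ Ici (1 : ℝ) \ Ioi a, Ka α (ξ / y) / y * wkbR α (rhoC α * y) W = 0 := by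
    intro y hy
    have : y ≤ a := not_lt.1 hy.2
    rw [ha, le_div_iff₀ hρ] at this
    rw [wkbR, Real.sqrt_eq_zero_of_nonpos (by linarith), mul_zero, mul_zero]
  have hsub : Ioi a ⊆ Ici 1 := fun y hy => ha1.trans (le_of_lt hy)
  set g : ℝ → ℝ := fun y => q / π * exp (W / 2) * A (√(rhoC α * y - m)) with hg
  have hcont : ContinuousWithinAt g (Ici a) a := by
    have hAc : Continuous A := continuous_iff_continuousAt.2 fun v => (hA v).continuousAt
    have : Continuous g := by rw [hg]; fun_prop
    exact this.continuousWithinAt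
  have hderiv : ∀ y ∈ Ioi a, HasDerivAt g (Ka α (ξ / y) / y * wkbR α (rhoC α * y) W) y := by
    intro y hy
    have hy0 : 0 < y := by linarith [mem_Ioi.1 hy]
    have hpos : 0 < rhoC α * y - m := by
      have := mem_Ioi.1 hy
      rw [ha, div_lt_iff₀ hρ] at this
      linarith
    have hd1 : HasDerivAt (fun y => rhoC α * y - m) (rhoC α) y := by
      simpa using ((hasDerivAt_id y).const_mul (rhoC α)).sub_const m
    refine (((hA _).comp y (hd1.sqrt hpos.ne')).const_mul _).congr_deriv ?_
    rw [Ka_div hy0.ne', wkbR, show rhoC α * y - exp (α * W) - exp (-W) = rhoC α * y - m by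
      rw [hm]; ring]
    rw [Real.sq_sqrt hpos.le]
    have hsq := Real.sq_sqrt hpos.le
    have hspos := Real.sqrt_pos.2 hpos
    set v := √(rhoC α * y - m)
    have hD : (rhoC α * y - m + p) ^ 2 + q ^ 2 =
        rhoC α ^ 2 * (y ^ 2 + ξ ^ 2 - 2 * ξ * y * cos (angleA α)) := by
      rw [hp, hq]
      linear_combination (rhoC α * ξ) ^ 2 * sin_sq_add_cos_sq (angleA α)
    have hDpos : 0 < (rhoC α * y - m + p) ^ 2 + q ^ 2 := by positivity
    rw [hD] at hDpos ⊢
    have hDpos' : 0 < y ^ 2 + ξ ^ 2 - 2 * ξ * y * cos (angleA α) :=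
      pos_of_mul_pos_right hDpos (sq_nonneg _)
    set D := y ^ 2 + ξ ^ 2 - 2 * ξ * y * cos (angleA α)
    rw [hq]
    field_simp
    exact hsq.symm
  have hnn : ∀ y ∈ Ioi a, 0 ≤ Ka α (ξ / y) / y * wkbR α (rhoC α * y) W := by
    intro y hy
    have hy0 : 0 < y := by linarith [mem_Ioi.1 hy]
    rw [Ka_div hy0.ne']
    have hD : 0 ≤ y ^ 2 + ξ ^ 2 - 2 * ξ * y * cos (angleA α) := by
      nlinarith [sq_nonneg (y - ξ * cos (angleA α)), sq_nonneg (ξ * sin (angleA α)),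
        sin_sq_add_cos_sq (angleA α)]
    have := wkbR_nonneg α (rhoC α * y) W
    have := pi_pos
    positivity
  have hlim : Tendsto g atTop (𝓝 (wkbTop α (rhoC α * ξ) W)) := by
    have h1 : Tendsto (fun y => √(rhoC α * y - m)) atTop atTop :=
      Real.tendsto_sqrt_atTop.comp
        (tendsto_atTop_add_const_right _ (-m) (tendsto_id.const_mul_atTop hρ))
    have h2 := (hAlim.comp h1).const_mul (q / π * exp (W / 2))
    have h3 : wkbTop α (rhoC α * ξ) W =
        q / π * exp (W / 2) * (π / q * √((√(p ^ 2 + q ^ 2) - p) / 2)) := by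
      rw [wkbTop, ← hm, ← hp, ← hq]
      generalize √((√(p ^ 2 + q ^ 2) - p) / 2) = c
      field_simp
    rw [h3]
    exact h2
  have hga : g a = 0 := by
    have : rhoC α * a - m = 0 := by rw [ha]; field_simp; ring
    simp [hg, this, hA0]
  refine ⟨?_, ?_⟩
  · exact (integrableOn_Ioi_deriv_of_nonneg hcont hderiv hnn hlim).of_forall_sdiff_eq_zero
      measurableSet_Ici hzero
  · rw [setIntegral_eq_of_subset_of_forall_sdiff_eq_zero measurableSet_Ici hsub hzero,
      integral_Ioi_of_hasDerivAt_of_nonneg hcont hderiv hnn hlim, hga, sub_zero]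

lemma Ka_div_den_pos {α ξ : ℝ} (hα : 1 < α) (hξ : 0 < ξ) (y : ℝ) :
    0 < y ^ 2 + ξ ^ 2 - 2 * ξ * y * cos (angleA α) := by
  have hs : 0 < sin (angleA α) := sin_pos_of_pos_of_lt_pi (angleA_pos hα) (angleA_lt_pi hα)
  have : 0 < (ξ * sin (angleA α)) ^ 2 := by positivity
  nlinarith [sq_nonneg (y - ξ * cos (angleA α)), sin_sq_add_cos_sq (angleA α)]

lemma Ka_div_nonneg {α ξ y : ℝ} (hα : 1 < α) (hξ : 0 < ξ) (hy : 0 < y) : 0 ≤ Ka α (ξ / y) / y := by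
  have hs : 0 < sin (angleA α) := sin_pos_of_pos_of_lt_pi (angleA_pos hα) (angleA_lt_pi hα)
  have := Ka_div_den_pos hα hξ y
  have := pi_pos
  rw [Ka_div hy.ne']
  positivity

lemma integrable_Ka_mul_wkbR_prod {α ξ : ℝ} (hα : 1 < α) (hξ : 1 ≤ ξ) :
    Integrable (fun z : ℝ × ℝ => Ka α (ξ / z.1) / z.1 * wkbR α (rhoC α * z.1) z.2)
      ((volume.restrict (Ici 1)).prod volume) := by
  have hξ0 : 0 < ξ := by linarith
  have hmeas : Measurable fun z : ℝ × ℝ =>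
      Ka α (ξ / z.1) / z.1 * wkbR α (rhoC α * z.1) z.2 := by
    unfold Ka wkbR
    fun_prop
  refine (integrable_prod_iff' hmeas.aestronglyMeasurable).2
    ⟨.of_forall fun W => (integral_Ka_mul_wkbR hα hξ0 W).1, ?_⟩
  refine (integrable_wkbTop hα (x := rhoC α * ξ) ?_).congr (.of_forall fun W => ?_)
  · nlinarith [rhoC_pos hα]
  · dsimp only
    rw [← (integral_Ka_mul_wkbR hα hξ0 W).2]
    refine setIntegral_congr_fun measurableSet_Ici fun y hy => ?_
    have hy0 : (0 : ℝ) < y := by linarith [mem_Ici.1 hy]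
    exact (Real.norm_of_nonneg
      (mul_nonneg (Ka_div_nonneg hα hξ0 hy0) (wkbR_nonneg α _ W))).symm

lemma integral_Ka_mul_wkbR_eq {α : ℝ} (hα : 1 < α) (ξ y : ℝ) :
    ∫ W, Ka α (ξ / y) / y * wkbR α (rhoC α * y) W =
      π / (1 + α) * (Ka α (ξ / y) * tauF α y / y) := by
  rw [integral_const_mul, tauF_eq hα]
  have := pi_pos
  field_simp

lemma integrableOn_Ka_mul_tauF {α ξ : ℝ} (hα : 1 < α) (hξ : 1 ≤ ξ) :
    IntegrableOn (fun y => Ka α (ξ / y) * tauF α y / y) (Ici 1) := by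
  have h := (integrable_Ka_mul_wkbR_prod hα hξ).integral_prod_left
  simp only [integral_Ka_mul_wkbR_eq hα] at h
  have hc : π / (1 + α) ≠ 0 := by
    have := pi_pos
    positivity
  exact (integrable_const_mul_iff (IsUnit.mk0 _ hc) _).1 h

lemma tauF_eq_neg_two_add {α ξ : ℝ} (hα : 1 < α) (hξ : 1 ≤ ξ) :
    tauF α ξ = -2 + Kconv α (Ici 1) (tauF α) ξ := by
  have h := integral_integral_swap
    (f := fun y W => Ka α (ξ / y) / y * wkbR α (rhoC α * y) W) (integrable_Ka_mul_wkbR_prod hα hξ)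
  simp only [integral_Ka_mul_wkbR_eq hα, (integral_Ka_mul_wkbR hα (zero_lt_one.trans_le hξ) _).2]
    at h
  rw [integral_const_mul, integral_wkbTop hα (by nlinarith [rhoC_pos hα])] at h
  rw [Kconv, tauF_eq hα ξ]
  have hθ := add_one_mul_angleA hα
  have hπ := pi_pos
  generalize ∫ W, wkbR α (rhoC α * ξ) W = c at *
  generalize ∫ y in Ici 1, Ka α (ξ / y) * tauF α y / y = d at *
  field_simp at h ⊢
  linarith

lemma integrableOn_tauF_div_sq {α : ℝ} (hα : 1 < α) :
    IntegrableOn (fun y => tauF α y / y ^ 2) (Ici 1) := by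
  have hs : 0 < sin (angleA α) := sin_pos_of_pos_of_lt_pi (angleA_pos hα) (angleA_lt_pi hα)
  have hπ := pi_pos
  have hmeas : StronglyMeasurable (tauF α) := by
    have : tauF α = fun ξ => (1 + α) / π * ∫ W, wkbR α (rhoC α * ξ) W := funext (tauF_eq hα)
    rw [this]
    refine stronglyMeasurable_const.mul (StronglyMeasurable.integral_prod_right
      (f := fun ξ W => wkbR α (rhoC α * ξ) W) (Measurable.stronglyMeasurable ?_))
    unfold wkbR Function.uncurry
    fun_prop
  refine ((integrableOn_Ka_mul_tauF hα le_rfl).const_mul (4 * π / sin (angleA α))).mono'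
    (hmeas.measurable.div (by fun_prop)).aestronglyMeasurable ?_
  filter_upwards [ae_restrict_mem measurableSet_Ici] with y hy
  have hy1 : 1 ≤ y := hy
  have hy0 : 0 < y := by linarith
  have ht := tauF_nonneg hα y
  have hD := Ka_div_den_pos hα one_pos y
  rw [Real.norm_of_nonneg (by positivity), mul_div_right_comm (Ka α _), Ka_div hy0.ne']
  have : 4 * π / sin (angleA α) * (sin (angleA α) / π *
      (1 / (y ^ 2 + 1 ^ 2 - 2 * 1 * y * cos (angleA α))) * tauF α y) =
      4 * tauF α y / (y ^ 2 + 1 ^ 2 - 2 * 1 * y * cos (angleA α)) := by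
    field_simp
  rw [this, div_le_div_iff₀ (by positivity) hD]
  have : y ^ 2 + 1 ^ 2 - 2 * 1 * y * cos (angleA α) ≤ 4 * y ^ 2 := by
    nlinarith [neg_one_le_cos (angleA α)]
  nlinarith

lemma exists_ball_le_norm_den {a : ℝ} (ha0 : 0 < a) (ha : a < π) {ξ : ℝ} (hξ : 0 < ξ) :
    ∃ r > 0, ∀ z ∈ Metric.ball (ξ : ℂ) r, ∀ y : ℝ, 1 ≤ y →
      sin a ^ 2 / 2 * y ^ 2 ≤ ‖(y : ℂ) ^ 2 + z ^ 2 - 2 * z * y * cos a‖ := by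
  have hs : 0 < sin a := sin_pos_of_pos_of_lt_pi ha0 ha
  set r := min 1 (sin a ^ 2 / (2 * (2 * ξ + 3))) with hr
  have hrpos : 0 < r := by positivity
  have hr1 : r ≤ 1 := min_le_left _ _
  have hr2 : r * (2 * ξ + 3) ≤ sin a ^ 2 / 2 := by
    have : r ≤ sin a ^ 2 / (2 * (2 * ξ + 3)) := min_le_right _ _
    rw [le_div_iff₀ (by positivity)] at this
    linarith
  refine ⟨r, hrpos, fun z hz y hy => ?_⟩
  have hzr : ‖z - ξ‖ < r := by simpa [dist_eq_norm] using hz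
  have h1 : sin a ^ 2 * y ^ 2 ≤ ‖(y : ℂ) ^ 2 + ξ ^ 2 - 2 * ξ * y * cos a‖ := by
    have : (y : ℂ) ^ 2 + ξ ^ 2 - 2 * ξ * y * cos a =
      ((y ^ 2 + ξ ^ 2 - 2 * ξ * y * cos a : ℝ) : ℂ) := by push_cast; ring
    rw [this, Complex.norm_real]
    refine le_trans ?_ (le_abs_self _)
    nlinarith [sq_nonneg (ξ - y * cos a), sin_sq_add_cos_sq a]
  have h2 : ‖((y : ℂ) ^ 2 + ξ ^ 2 - 2 * ξ * y * cos a) -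
      ((y : ℂ) ^ 2 + z ^ 2 - 2 * z * y * cos a)‖ ≤ sin a ^ 2 / 2 * y ^ 2 := by
    have : ((y : ℂ) ^ 2 + ξ ^ 2 - 2 * ξ * y * cos a) - ((y : ℂ) ^ 2 + z ^ 2 - 2 * z * y * cos a) =
        -((z - ξ) * ((z - ξ) + 2 * ξ - 2 * y * cos a)) := by ring
    rw [this, norm_neg, norm_mul]
    have h3 : ‖(z - ξ) + 2 * ξ - 2 * y * (cos a : ℂ)‖ ≤ (2 * ξ + 3) * y ^ 2 := by
      refine (norm_sub_le _ _).trans ((add_le_add_left (norm_add_le _ _) _).trans ?_)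
      have e1 : ‖(2 : ℂ) * ξ‖ = 2 * ξ := by simp [abs_of_pos hξ]
      have e2 : ‖(2 : ℂ) * y * (cos a : ℂ)‖ ≤ 2 * y := by
        rw [norm_mul, norm_mul, Complex.norm_real, Complex.norm_real, Real.norm_eq_abs,
          Real.norm_eq_abs, Complex.norm_two, abs_of_pos (by linarith : 0 < y)]
        nlinarith [abs_cos_le_one a]
      rw [e1]
      have hy2 : y ≤ y ^ 2 := by nlinarith
      nlinarith
    calc ‖z - ξ‖ * ‖(z - ξ) + 2 * ξ - 2 * y * (cos a : ℂ)‖ ≤ r * ((2 * ξ + 3) * y ^ 2) := by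
          gcongr
      _ ≤ _ := by nlinarith [sq_nonneg y]
  have h4 := norm_sub_norm_le ((y : ℂ) ^ 2 + ξ ^ 2 - 2 * ξ * y * cos a)
    ((y : ℂ) ^ 2 + z ^ 2 - 2 * z * y * cos a)
  linarith

lemma hasDerivAt_kernel {a y z : ℂ} (h : y ^ 2 + z ^ 2 - 2 * z * y * a ≠ 0) :
    HasDerivAt (fun z => z / (y ^ 2 + z ^ 2 - 2 * z * y * a))
      ((y ^ 2 - z ^ 2) / (y ^ 2 + z ^ 2 - 2 * z * y * a) ^ 2) z := by
  have h1 : HasDerivAt (fun z => y ^ 2 + z ^ 2 - 2 * z * y * a) (2 * z - 2 * y * a) z := by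
    have := (((hasDerivAt_id z).pow 2).const_add (y ^ 2)).sub
      ((((hasDerivAt_id z).const_mul 2).mul_const y).mul_const a)
    exact this.congr_deriv (by simp)
  refine ((hasDerivAt_id z).div h1 h).congr_deriv ?_
  simp only [id]
  congr 1
  ring

lemma hasDerivAt_integral_kernel {a : ℝ} (ha0 : 0 < a) (ha : a < π) {f : ℝ → ℝ}
    (hf : IntegrableOn (fun y => f y / y ^ 2) (Ici 1)) {ξ : ℝ} (hξ : 0 < ξ) :
    ∀ᶠ z in 𝓝 (ξ : ℂ), HasDerivAt
      (fun z : ℂ => ∫ y in Ici (1 : ℝ), z / ((y : ℂ) ^ 2 + z ^ 2 - 2 * z * y * cos a) * f y)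
      (∫ y in Ici (1 : ℝ), ((y : ℂ) ^ 2 - z ^ 2) /
        ((y : ℂ) ^ 2 + z ^ 2 - 2 * z * y * cos a) ^ 2 * f y) z := by
  have hs : 0 < sin a := sin_pos_of_pos_of_lt_pi ha0 ha
  obtain ⟨r, hr, hden⟩ := exists_ball_le_norm_den ha0 ha hξ
  have hfm : AEMeasurable f (volume.restrict (Ici 1)) := by
    have h1 : AEMeasurable (fun y => f y / y ^ 2 * y ^ 2) (volume.restrict (Ici 1)) :=
      hf.aestronglyMeasurable.aemeasurable.mul (by fun_prop)
    refine h1.congr ?_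
    filter_upwards [ae_restrict_mem measurableSet_Ici] with y hy
    have : y ≠ 0 := by linarith [mem_Ici.1 hy]
    field_simp
  have hfm' : AEMeasurable (fun y => (f y : ℂ)) (volume.restrict (Ici 1)) :=
    Complex.measurable_ofReal.comp_aemeasurable hfm
  have hnorm : ∀ z ∈ Metric.ball (ξ : ℂ) r, ‖z‖ ≤ ξ + r := by
    intro z hz
    have hzr : ‖z - ξ‖ < r := by simpa [dist_eq_norm] using hz
    have := norm_sub_norm_le z (ξ : ℂ)
    rw [Complex.norm_real, Real.norm_of_nonneg hξ.le] at this
    linarith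
  have hpos : ∀ z ∈ Metric.ball (ξ : ℂ) r, ∀ y : ℝ, 1 ≤ y →
      0 < ‖(y : ℂ) ^ 2 + z ^ 2 - 2 * z * y * cos a‖ := fun z hz y hy =>
    lt_of_lt_of_le (by positivity) (hden z hz y hy)
  filter_upwards [Metric.ball_mem_nhds (ξ : ℂ) hr] with z hz
  refine (hasDerivAt_integral_of_dominated_loc_of_deriv_le
    (F := fun (z : ℂ) (y : ℝ) => z / ((y : ℂ) ^ 2 + z ^ 2 - 2 * z * y * cos a) * f y)
    (F' := fun (z : ℂ) (y : ℝ) => ((y : ℂ) ^ 2 - z ^ 2) /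
        ((y : ℂ) ^ 2 + z ^ 2 - 2 * z * y * cos a) ^ 2 * f y)
    (bound := fun y => (1 + (ξ + r) ^ 2) * 4 / sin a ^ 4 * ‖f y / y ^ 2‖)
    (Metric.isOpen_ball.mem_nhds hz) ?_ ?_ ?_ ?_ ?_ ?_).2
  · refine .of_forall fun z => AEMeasurable.aestronglyMeasurable ?_
    exact AEMeasurable.mul (Measurable.aemeasurable (by fun_prop)) hfm'
  · refine (hf.norm.const_mul ((ξ + r) * 2 / sin a ^ 2)).mono' (AEMeasurable.aestronglyMeasurable
      (AEMeasurable.mul (Measurable.aemeasurable (by fun_prop)) hfm')) ?_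
    filter_upwards [ae_restrict_mem measurableSet_Ici] with y hy
    have hy0 : 0 < y := by linarith [mem_Ici.1 hy]
    rw [norm_mul, norm_div, Complex.norm_real, norm_div, norm_pow, Real.norm_of_nonneg hy0.le]
    calc ‖z‖ / ‖(y : ℂ) ^ 2 + z ^ 2 - 2 * z * y * cos a‖ * ‖f y‖
        ≤ (ξ + r) / (sin a ^ 2 / 2 * y ^ 2) * ‖f y‖ := by
          gcongr
          · exact hnorm z hz
          · exact hden z hz y hy
      _ = _ := by field_simp
  · exact AEMeasurable.aestronglyMeasurable
      (AEMeasurable.mul (Measurable.aemeasurable (by fun_prop)) hfm')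
  · filter_upwards [ae_restrict_mem measurableSet_Ici] with y hy w hw
    have hy1 : 1 ≤ y := hy
    have hy0 : 0 < y := by linarith [mem_Ici.1 hy]
    rw [norm_mul, norm_div, Complex.norm_real, norm_div, norm_pow, norm_pow,
      Real.norm_of_nonneg hy0.le]
    have h1 : ‖(y : ℂ) ^ 2 - w ^ 2‖ ≤ (1 + (ξ + r) ^ 2) * y ^ 2 := by
      refine (norm_sub_le _ _).trans ?_
      rw [norm_pow, norm_pow, Complex.norm_real, Real.norm_of_nonneg hy0.le]
      have : ‖w‖ ^ 2 ≤ (ξ + r) ^ 2 := by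
        gcongr
        exact hnorm w hw
      have hy2 : 1 ≤ y ^ 2 := by nlinarith
      nlinarith [sq_nonneg (ξ + r)]
    calc ‖(y : ℂ) ^ 2 - w ^ 2‖ / ‖(y : ℂ) ^ 2 + w ^ 2 - 2 * w * y * cos a‖ ^ 2 * ‖f y‖
        ≤ (1 + (ξ + r) ^ 2) * y ^ 2 / (sin a ^ 2 / 2 * y ^ 2) ^ 2 * ‖f y‖ := by
          gcongr
          exact hden w hw y hy
      _ = _ := by field_simp; ring
  · exact hf.norm.const_mul _
  · filter_upwards [ae_restrict_mem measurableSet_Ici] with y hy w hw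
    exact (hasDerivAt_kernel (norm_pos_iff.1 (hpos w hw y hy))).mul_const _

lemma hasDerivAt_integral_real_kernel {a : ℝ} (ha0 : 0 < a) (ha : a < π) {f : ℝ → ℝ}
    (hf : IntegrableOn (fun y => f y / y ^ 2) (Ici 1)) {ξ : ℝ} (hξ : 0 < ξ) :
    HasDerivAt (fun ξ => ∫ y in Ici (1 : ℝ), ξ / (y ^ 2 + ξ ^ 2 - 2 * ξ * y * cos a) * f y)
      (∫ y in Ici (1 : ℝ), (y ^ 2 - ξ ^ 2) / (y ^ 2 + ξ ^ 2 - 2 * ξ * y * cos a) ^ 2 * f y) ξ ∧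
    ContDiffAt ℝ (⊤ : ℕ∞)
      (fun ξ => ∫ y in Ici (1 : ℝ), ξ / (y ^ 2 + ξ ^ 2 - 2 * ξ * y * cos a) * f y) ξ := by
  have h := hasDerivAt_integral_kernel ha0 ha hf hξ
  have hG : (fun ξ : ℝ => (∫ y in Ici (1 : ℝ),
      (ξ : ℂ) / ((y : ℂ) ^ 2 + (ξ : ℂ) ^ 2 - 2 * ξ * y * cos a) * f y).re) =
      fun ξ => ∫ y in Ici (1 : ℝ), ξ / (y ^ 2 + ξ ^ 2 - 2 * ξ * y * cos a) * f y := by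
    funext ξ
    rw [← Complex.ofReal_re (∫ y in Ici (1 : ℝ), _), ← integral_complex_ofReal]
    push_cast
    rfl
  rw [← hG]
  constructor
  · refine h.self_of_nhds.real_of_complex.congr_deriv ?_
    rw [← Complex.ofReal_re (∫ y in Ici (1 : ℝ), _), ← integral_complex_ofReal]
    push_cast
    rfl
  · have han := (Complex.analyticAt_iff_eventually_differentiableAt.2
      (h.mono fun z hz => hz.differentiableAt)).contDiffAt (n := ((⊤ : ℕ∞) : WithTop ℕ∞))
    exact han.real_of_complex

/-- The smooth extension of `τ` from `[1, ∞)` to a neighbourhood. -/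
def tauExt (α ξ : ℝ) : ℝ := -2 + sin (angleA α) / π *
  ∫ y in Ici (1 : ℝ), ξ / (y ^ 2 + ξ ^ 2 - 2 * ξ * y * cos (angleA α)) * tauF α y

lemma Kconv_Ici_one (α : ℝ) (f : ℝ → ℝ) (ξ : ℝ) : Kconv α (Ici 1) f ξ =
    ∫ y in Ici (1 : ℝ), sin (angleA α) / π *
      (ξ / (y ^ 2 + ξ ^ 2 - 2 * ξ * y * cos (angleA α)) * f y) := by
  refine setIntegral_congr_fun measurableSet_Ici fun y hy => ?_
  have hy0 : y ≠ 0 := by linarith [mem_Ici.1 hy]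
  rw [mul_div_right_comm (Ka α _), Ka_div hy0, mul_assoc]

lemma tauF_eq_tauExt {α ξ : ℝ} (hα : 1 < α) (hξ : 1 ≤ ξ) : tauF α ξ = tauExt α ξ := by
  rw [tauF_eq_neg_two_add hα hξ, Kconv_Ici_one, integral_const_mul, tauExt]

lemma hasDerivAt_tauExt {α ξ : ℝ} (hα : 1 < α) (hξ : 0 < ξ) :
    HasDerivAt (tauExt α) (sin (angleA α) / π * ∫ y in Ici (1 : ℝ), (y ^ 2 - ξ ^ 2) /
      (y ^ 2 + ξ ^ 2 - 2 * ξ * y * cos (angleA α)) ^ 2 * tauF α y) ξ :=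
  ((hasDerivAt_integral_real_kernel (angleA_pos hα) (angleA_lt_pi hα)
    (integrableOn_tauF_div_sq hα) hξ).1.const_mul _).const_add _

lemma contDiffAt_tauExt {α ξ : ℝ} (hα : 1 < α) (hξ : 0 < ξ) :
    ContDiffAt ℝ (⊤ : ℕ∞) (tauExt α) ξ :=
  contDiffAt_const.add (contDiffAt_const.mul
    (hasDerivAt_integral_real_kernel (angleA_pos hα) (angleA_lt_pi hα)
      (integrableOn_tauF_div_sq hα) hξ).2)

lemma contDiffOn_tauF {α : ℝ} (hα : 1 < α) : ContDiffOn ℝ (⊤ : ℕ∞) (tauF α) (Ici 1) := by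
  have h : ContDiffOn ℝ (⊤ : ℕ∞) (tauExt α) (Ici 1) := fun ξ hξ =>
    (contDiffAt_tauExt hα (zero_lt_one.trans_le hξ)).contDiffWithinAt
  exact h.congr fun ξ hξ => tauF_eq_tauExt hα hξ

lemma continuousOn_tauF {α : ℝ} (hα : 1 < α) : ContinuousOn (tauF α) (Ici 0) := by
  have h1 : ContinuousOn (tauF α) (Icc 0 1) :=
    continuousOn_const.congr fun ξ hξ => tauF_eq_zero hα hξ.2
  have h2 := h1.union_of_isClosed (contDiffOn_tauF hα).continuousOn isClosed_Icc isClosed_Ici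
  rwa [Icc_union_Ici_eq_Ici zero_le_one] at h2

lemma derivWithin_tauF {α ξ : ℝ} (hα : 1 < α) (hξ : 1 ≤ ξ) :
    derivWithin (tauF α) (Ici 1) ξ = deriv (tauExt α) ξ := by
  have hd := hasDerivAt_tauExt hα (zero_lt_one.trans_le hξ)
  rw [hd.deriv, derivWithin_congr (f := tauExt α) (s := Ici 1) (fun y hy => tauF_eq_tauExt hα hy)
    (tauF_eq_tauExt hα hξ)]
  exact hd.hasDerivWithinAt.derivWithin (uniqueDiffOn_Ici 1 ξ hξ)

lemma sin_sq_mul_sq_le (a ξ y : ℝ) :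
    sin a ^ 2 * y ^ 2 ≤ y ^ 2 + ξ ^ 2 - 2 * ξ * y * cos a := by
  nlinarith [sq_nonneg (ξ - y * cos a), sin_sq_add_cos_sq a]

lemma abs_sq_sub_sq_le (a ξ y : ℝ) :
    (1 - |cos a|) * |y ^ 2 - ξ ^ 2| ≤ y ^ 2 + ξ ^ 2 - 2 * ξ * y * cos a := by
  have h1 : |y ^ 2 - ξ ^ 2| ≤ y ^ 2 + ξ ^ 2 :=
    abs_le.2 ⟨by nlinarith [sq_nonneg y], by nlinarith [sq_nonneg ξ]⟩
  have h2 : 2 * ξ * y * cos a ≤ (y ^ 2 + ξ ^ 2) * |cos a| := by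
    refine (le_abs_self _).trans ?_
    rw [abs_mul]
    refine mul_le_mul_of_nonneg_right (abs_le.2 ⟨?_, ?_⟩) (abs_nonneg _)
    · nlinarith [sq_nonneg (ξ + y)]
    · nlinarith [sq_nonneg (ξ - y)]
  nlinarith [mul_le_mul_of_nonneg_left h1 (sub_nonneg.2 (abs_cos_le_one a))]

lemma integrableOn_kernel_mul_tauF {α ξ : ℝ} (hα : 1 < α) (hξ : 1 ≤ ξ) :
    IntegrableOn (fun y => ξ / (y ^ 2 + ξ ^ 2 - 2 * ξ * y * cos (angleA α)) * tauF α y)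
      (Ici 1) := by
  have hs : 0 < sin (angleA α) := sin_pos_of_pos_of_lt_pi (angleA_pos hα) (angleA_lt_pi hα)
  have hπ := pi_pos
  refine IntegrableOn.congr_fun
    ((integrableOn_Ka_mul_tauF hα hξ).const_mul (π / sin (angleA α))) ?_ measurableSet_Ici
  intro y hy
  have hy0 : y ≠ 0 := by linarith [mem_Ici.1 hy]
  dsimp only
  rw [mul_div_right_comm (Ka α _), Ka_div hy0]
  generalize ξ / (y ^ 2 + ξ ^ 2 - 2 * ξ * y * cos (angleA α)) = c
  field_simp

lemma abs_mul_deriv_tauExt_le {α ξ : ℝ} (hα : 1 < α) (hξ : 1 ≤ ξ) :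
    (1 - |cos (angleA α)|) * (ξ * |deriv (tauExt α) ξ|) ≤ tauF α ξ + 2 := by
  have hξ0 : 0 < ξ := by linarith
  have hs : 0 < sin (angleA α) := sin_pos_of_pos_of_lt_pi (angleA_pos hα) (angleA_lt_pi hα)
  have hπ := pi_pos
  have hc := sub_nonneg.2 (abs_cos_le_one (angleA α))
  rw [(hasDerivAt_tauExt hα hξ0).deriv, tauF_eq_tauExt hα hξ, tauExt, neg_add_cancel_comm,
    abs_mul, abs_of_pos (by positivity : 0 < sin (angleA α) / π)]
  suffices h : (1 - |cos (angleA α)|) * ξ * ‖∫ y in Ici (1 : ℝ), (y ^ 2 - ξ ^ 2) /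
      (y ^ 2 + ξ ^ 2 - 2 * ξ * y * cos (angleA α)) ^ 2 * tauF α y‖ ≤
      ∫ y in Ici (1 : ℝ), ξ / (y ^ 2 + ξ ^ 2 - 2 * ξ * y * cos (angleA α)) * tauF α y by
    have := mul_le_mul_of_nonneg_left h (by positivity : 0 ≤ sin (angleA α) / π)
    rw [Real.norm_eq_abs] at this
    linarith
  have hn := norm_of_nonneg (mul_nonneg hc hξ0.le)
  conv_lhs => enter [1]; rw [← hn]
  rw [← norm_mul, ← integral_const_mul]
  refine norm_integral_le_of_norm_le (integrableOn_kernel_mul_tauF hα hξ) (.of_forall fun y => ?_)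
  have hD := Ka_div_den_pos hα hξ0 y
  have hab := abs_sq_sub_sq_le (angleA α) ξ y
  have ht := tauF_nonneg hα y
  rw [norm_mul, hn, norm_mul, norm_div, norm_pow, Real.norm_of_nonneg hD.le,
    Real.norm_of_nonneg ht, Real.norm_eq_abs, ← mul_assoc]
  refine mul_le_mul_of_nonneg_right ?_ ht
  rw [← mul_div_assoc, div_le_div_iff₀ (by positivity) hD]
  nlinarith [mul_le_mul_of_nonneg_left hab (mul_nonneg hξ0.le hD.le)]

lemma tendsto_tauExt_div {α : ℝ} (hα : 1 < α) :
    Tendsto (fun ξ => tauExt α ξ / ξ) atTop (𝓝 0) := by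
  have hs : 0 < sin (angleA α) := sin_pos_of_pos_of_lt_pi (angleA_pos hα) (angleA_lt_pi hα)
  have hdom := integrableOn_tauF_div_sq hα
  have hmeas : AEMeasurable (tauF α) (volume.restrict (Ici 1)) :=
    ((continuousOn_tauF hα).mono (Ici_subset_Ici.2 zero_le_one)).aemeasurable measurableSet_Ici
  have h : Tendsto (fun ξ => ∫ y in Ici (1 : ℝ),
      1 / (y ^ 2 + ξ ^ 2 - 2 * ξ * y * cos (angleA α)) * tauF α y) atTop
      (𝓝 (∫ y in Ici (1 : ℝ), 0)) := by
    refine tendsto_integral_filter_of_dominated_convergence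
      (fun y => 1 / sin (angleA α) ^ 2 * ‖tauF α y / y ^ 2‖) (.of_forall fun ξ => ?_) ?_
      (hdom.norm.const_mul _) (.of_forall fun y => ?_)
    · exact (AEMeasurable.mul (Measurable.aemeasurable (by fun_prop)) hmeas).aestronglyMeasurable
    · filter_upwards [eventually_gt_atTop 0] with ξ hξ
      filter_upwards [ae_restrict_mem measurableSet_Ici] with y hy
      have hy0 : 0 < y := by linarith [mem_Ici.1 hy]
      have hD := Ka_div_den_pos hα hξ y
      rw [norm_mul, norm_div, norm_div, norm_pow, Real.norm_of_nonneg hD.le, norm_one,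
        Real.norm_of_nonneg hy0.le]
      calc 1 / (y ^ 2 + ξ ^ 2 - 2 * ξ * y * cos (angleA α)) * ‖tauF α y‖
          ≤ 1 / (sin (angleA α) ^ 2 * y ^ 2) * ‖tauF α y‖ := by
            gcongr
            exact sin_sq_mul_sq_le _ _ _
        _ = _ := by field_simp
    · have h0 : Tendsto (fun ξ => 1 / (y ^ 2 + ξ ^ 2 - 2 * ξ * y * cos (angleA α))) atTop
          (𝓝 0) := by
        refine squeeze_zero' (g := fun ξ => 1 / (sin (angleA α) ^ 2 * ξ ^ 2)) ?_ ?_ ?_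
        · filter_upwards [eventually_gt_atTop 0] with ξ hξ
          have hD := Ka_div_den_pos hα hξ y
          positivity
        · filter_upwards [eventually_gt_atTop 0] with ξ hξ
          refine one_div_le_one_div_of_le (by positivity) ?_
          have := sin_sq_mul_sq_le (angleA α) y ξ
          linarith
        · exact tendsto_const_nhds.div_atTop
            ((tendsto_pow_atTop two_ne_zero).const_mul_atTop (by positivity))
      simpa using h0.mul_const (tauF α y)
  have h2 := ((tendsto_const_nhds (x := (-2 : ℝ))).div_atTop tendsto_id).add
    (h.const_mul (sin (angleA α) / π))
  simp only [integral_zero, mul_zero, add_zero] at h2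
  refine h2.congr' ?_
  filter_upwards [eventually_gt_atTop 0] with ξ hξ
  rw [tauExt, add_div, mul_div_assoc, ← integral_div, id]
  congr 2
  refine integral_congr_ae (.of_forall fun y => ?_)
  have hD := Ka_div_den_pos hα hξ y
  dsimp only
  generalize y ^ 2 + ξ ^ 2 - 2 * ξ * y * cos (angleA α) = D at *
  field_simp

lemma hasDerivAt_mul_kernel {α ξ : ℝ} (hα : 1 < α) (hξ : 0 < ξ) (y : ℝ) :
    HasDerivAt (fun y => ξ * y / (y ^ 2 + ξ ^ 2 - 2 * ξ * y * cos (angleA α)))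
      (-(ξ * ((y ^ 2 - ξ ^ 2) / (y ^ 2 + ξ ^ 2 - 2 * ξ * y * cos (angleA α)) ^ 2))) y := by
  have h1 : HasDerivAt (fun y => y ^ 2 + ξ ^ 2 - 2 * ξ * y * cos (angleA α))
      (2 * y - 2 * ξ * cos (angleA α)) y := by
    have := (((hasDerivAt_id y).pow 2).add_const (ξ ^ 2)).sub
      (((hasDerivAt_id y).const_mul (2 * ξ)).mul_const (cos (angleA α)))
    exact this.congr_deriv (by simp)
  refine (((hasDerivAt_id y).const_mul ξ).div h1 (Ka_div_den_pos hα hξ y).ne').congr_deriv ?_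
  simp only [id]
  rw [← mul_div_assoc, ← neg_div]
  congr 1
  ring

lemma one_sub_abs_cos_angleA_pos {α : ℝ} (hα : 1 < α) : 0 < 1 - |cos (angleA α)| := by
  have hs : 0 < sin (angleA α) := sin_pos_of_pos_of_lt_pi (angleA_pos hα) (angleA_lt_pi hα)
  have : |cos (angleA α)| ^ 2 < 1 := by
    rw [sq_abs]
    nlinarith [sin_sq_add_cos_sq (angleA α)]
  nlinarith [abs_nonneg (cos (angleA α))]

lemma integrableOn_mul_kernel_mul_deriv {α ξ : ℝ} (hα : 1 < α) (hξ : 1 ≤ ξ) :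
    IntegrableOn (fun y => ξ * y / (y ^ 2 + ξ ^ 2 - 2 * ξ * y * cos (angleA α)) *
      deriv (tauExt α) y) (Ioi 1) := by
  have hξ0 : 0 < ξ := by linarith
  have hs : 0 < sin (angleA α) := sin_pos_of_pos_of_lt_pi (angleA_pos hα) (angleA_lt_pi hα)
  have hc := one_sub_abs_cos_angleA_pos hα
  have hsq : IntegrableOn (fun y : ℝ => y ^ (-2 : ℝ)) (Ioi 1) :=
    integrableOn_Ioi_rpow_of_lt (by norm_num) one_pos
  have hb := (((integrableOn_kernel_mul_tauF hα hξ).mono_set Ioi_subset_Ici_self).add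
    (hsq.const_mul (2 * ξ / sin (angleA α) ^ 2))).const_mul (1 / (1 - |cos (angleA α)|))
  refine hb.mono' ?_ ?_
  · exact (Measurable.mul (by fun_prop) (measurable_deriv _)).aestronglyMeasurable
  · filter_upwards [ae_restrict_mem measurableSet_Ioi] with y hy
    have hy1 : 1 ≤ y := le_of_lt hy
    have hy0 : 0 < y := by linarith
    have hD := Ka_div_den_pos hα hξ0 y
    have hd := abs_mul_deriv_tauExt_le hα hy1
    have ht := tauF_nonneg hα y
    have hDs := sin_sq_mul_sq_le (angleA α) ξ y
    rw [norm_mul, Real.norm_of_nonneg (by positivity), Real.norm_eq_abs, Pi.add_apply,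
      Real.rpow_neg hy0.le, Real.rpow_two, one_div, ← div_eq_inv_mul, le_div_iff₀ hc]
    set D := y ^ 2 + ξ ^ 2 - 2 * ξ * y * cos (angleA α)
    calc ξ * y / D * |deriv (tauExt α) y| * (1 - |cos (angleA α)|)
        = ξ / D * ((1 - |cos (angleA α)|) * (y * |deriv (tauExt α) y|)) := by ring
      _ ≤ ξ / D * (tauF α y + 2) := by gcongr
      _ = ξ / D * tauF α y + 2 * ξ * (1 / D) := by ring
      _ ≤ ξ / D * tauF α y + 2 * ξ * (1 / (sin (angleA α) ^ 2 * y ^ 2)) := by gcongr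
      _ = _ := by field_simp

lemma integrableOn_deriv_mul_kernel_mul {α ξ : ℝ} (hα : 1 < α) (hξ : 1 ≤ ξ) :
    IntegrableOn (fun y => -(ξ * ((y ^ 2 - ξ ^ 2) /
      (y ^ 2 + ξ ^ 2 - 2 * ξ * y * cos (angleA α)) ^ 2)) * tauExt α y) (Ioi 1) := by
  have hξ0 : 0 < ξ := by linarith
  have hc := one_sub_abs_cos_angleA_pos hα
  have hcont : ContinuousOn (tauExt α) (Ioi 1) := fun y hy =>
    (contDiffAt_tauExt hα (zero_lt_one.trans hy)).continuousAt.continuousWithinAt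
  have hb := ((integrableOn_kernel_mul_tauF hα hξ).mono_set Ioi_subset_Ici_self).const_mul
    (1 / (1 - |cos (angleA α)|))
  refine hb.mono' ?_ ?_
  · exact (AEMeasurable.mul (Measurable.aemeasurable (by fun_prop))
      (hcont.aemeasurable measurableSet_Ioi)).aestronglyMeasurable
  · filter_upwards [ae_restrict_mem measurableSet_Ioi] with y hy
    have hy1 : 1 ≤ y := le_of_lt hy
    have hD := Ka_div_den_pos hα hξ0 y
    have hab := abs_sq_sub_sq_le (angleA α) ξ y
    have ht := tauF_nonneg hα y
    rw [← tauF_eq_tauExt hα hy1, norm_mul, norm_neg, norm_mul, norm_div, norm_pow,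
      Real.norm_of_nonneg hD.le, Real.norm_of_nonneg ht, Real.norm_of_nonneg hξ0.le,
      Real.norm_eq_abs, one_div, ← div_eq_inv_mul, le_div_iff₀ hc]
    set D := y ^ 2 + ξ ^ 2 - 2 * ξ * y * cos (angleA α)
    calc ξ * (|y ^ 2 - ξ ^ 2| / D ^ 2) * tauF α y * (1 - |cos (angleA α)|)
        = ξ * (((1 - |cos (angleA α)|) * |y ^ 2 - ξ ^ 2|) / D ^ 2) * tauF α y := by ring
      _ ≤ ξ * (D / D ^ 2) * tauF α y := by gcongr
      _ = _ := by field_simp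

lemma tendsto_mul_kernel_mul_tauExt {α ξ : ℝ} (hα : 1 < α) (hξ : 0 < ξ) :
    Tendsto (fun y => ξ * y / (y ^ 2 + ξ ^ 2 - 2 * ξ * y * cos (angleA α)) * tauExt α y) atTop
      (𝓝 0) := by
  have hs : 0 < sin (angleA α) := sin_pos_of_pos_of_lt_pi (angleA_pos hα) (angleA_lt_pi hα)
  have h := (tendsto_tauExt_div hα).norm.const_mul (ξ / sin (angleA α) ^ 2)
  rw [norm_zero, mul_zero] at h
  refine squeeze_zero_norm' ?_ h
  filter_upwards [eventually_gt_atTop 0] with y hy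
  have hD := Ka_div_den_pos hα hξ y
  have hDs := sin_sq_mul_sq_le (angleA α) ξ y
  rw [norm_mul, norm_div, norm_div, Real.norm_of_nonneg hD.le, Real.norm_of_nonneg hy.le,
    Real.norm_of_nonneg (by positivity)]
  calc ξ * y / (y ^ 2 + ξ ^ 2 - 2 * ξ * y * cos (angleA α)) * ‖tauExt α y‖
      ≤ ξ * y / (sin (angleA α) ^ 2 * y ^ 2) * ‖tauExt α y‖ := by gcongr
    _ = _ := by field_simp

lemma eulerDW_tauF_eq_Kconv {α ξ : ℝ} (hα : 1 < α) (hξ : 1 ≤ ξ) :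
    eulerDW (Ici 1) (tauF α) ξ = Kconv α (Ici 1) (eulerDW (Ici 1) (tauF α)) ξ := by
  have hξ0 : 0 < ξ := by linarith
  have hparts := integral_Ioi_mul_deriv_eq_deriv_mul
    (fun y _ => hasDerivAt_mul_kernel hα hξ0 y)
    (fun y (hy : y ∈ Ioi (1 : ℝ)) => (hasDerivAt_tauExt hα
      (zero_lt_one.trans hy)).differentiableAt.hasDerivAt)
    (integrableOn_mul_kernel_mul_deriv hα hξ) (integrableOn_deriv_mul_kernel_mul hα hξ)
    (((hasDerivAt_mul_kernel hα hξ0 1).continuousAt.mul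
      (hasDerivAt_tauExt hα one_pos).continuousAt).tendsto.mono_left nhdsWithin_le_nhds)
    (tendsto_mul_kernel_mul_tauExt hα hξ0)
  rw [Pi.mul_apply, ← tauF_eq_tauExt hα le_rfl, tauF_eq_zero hα le_rfl, mul_zero, sub_zero, zero_sub,
    ← integral_neg] at hparts
  rw [Kconv_Ici_one, integral_const_mul, eulerDW, derivWithin_tauF hα hξ,
    (hasDerivAt_tauExt hα hξ0).deriv, mul_left_comm, ← integral_const_mul]
  congr 1
  rw [integral_Ici_eq_integral_Ioi, integral_Ici_eq_integral_Ioi]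
  calc _ = ∫ y in Ioi 1, -(-(ξ * ((y ^ 2 - ξ ^ 2) /
        (y ^ 2 + ξ ^ 2 - 2 * ξ * y * cos (angleA α)) ^ 2)) * tauExt α y) := by
        refine setIntegral_congr_fun measurableSet_Ioi fun y hy => ?_
        rw [← tauF_eq_tauExt hα (le_of_lt hy)]
        ring
    _ = _ := by
        rw [← hparts]
        refine setIntegral_congr_fun measurableSet_Ioi fun y hy => ?_
        rw [eulerDW, derivWithin_tauF hα (le_of_lt hy)]
        ring

theorem statement6 (α : ℝ) (hα : 1 < α) :
    -- (i) τ : [0,∞) → [0,∞) is continuous and vanishes on [0,1]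
    ContinuousOn (tauF α) (Set.Ici 0) ∧
    (∀ ξ : ℝ, 0 ≤ ξ → 0 ≤ tauF α ξ) ∧
    (∀ ξ : ℝ, 0 ≤ ξ → ξ ≤ 1 → tauF α ξ = 0) ∧
    -- (ii) τ restricted to [1,∞) is smooth
    ContDiffOn ℝ (⊤ : ℕ∞) (tauF α) (Set.Ici 1) ∧
    -- (iii) τ solves the inhomogeneous equation, Dτ the homogeneous one
    (∀ ξ : ℝ, 1 ≤ ξ → tauF α ξ = -2 + Kconv α (Set.Ici 1) (tauF α) ξ) ∧
    (∀ ξ : ℝ, 1 ≤ ξ →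
      eulerDW (Set.Ici 1) (tauF α) ξ =
        Kconv α (Set.Ici 1) (eulerDW (Set.Ici 1) (tauF α)) ξ) := by
  exact ⟨continuousOn_tauF hα, fun ξ _ => tauF_nonneg hα ξ, fun ξ _ hξ => tauF_eq_zero hα hξ,
    contDiffOn_tauF hα, fun ξ hξ => tauF_eq_neg_two_add hα hξ,
    fun ξ hξ => eulerDW_tauF_eq_Kconv hα hξ⟩
end
end
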